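/- arXiv:1911.06060 — 3 statements merged into one kernel-verified Lean document; each statement's English description precedes it below -/
import Mathlib

section
/- Let G be a connected k-regular finite simple graph with n vertices and m edges, where k > 2 and the girth g(G) > 4, and let U be its Grover transition matrix and A = A(G) its adjacency matrix. Then for every real number u, det(I_{2m} − u·(U³)⁺) = (1 − 4u²)^{m−n} · det( I_n − u·(A³ − (3k−4)·A) + u²·(A⁴ − k²·A² + 2(k−1)(k²−2k+2)·I_n) ). -/
open Matrix SimpleGraph

variable {V : Type*} [Fintype V] [DecidableEq V]

/-- The Grover transition matrix `U` of a graph `G`, indexed by darts (arcs):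
`U e f = 2/deg(t(f)) - 1` if `f = e⁻¹`, `U e f = 2/deg(t(f))` if `t(f) = o(e)` and
`f ≠ e⁻¹`, and `0` otherwise.  (When `t(f) = o(e)` we have `deg (t f) = deg (o e)`.) -/
noncomputable def grover (G : SimpleGraph V) [DecidableRel G.Adj] :
    Matrix G.Dart G.Dart ℝ := fun e f =>
  if f = e.symm then 2 / (G.degree e.toProd.1) - 1
  else if f.toProd.2 = e.toProd.1 then 2 / (G.degree e.toProd.1) else 0

/-- The positive support of a real square matrix. -/
noncomputable def posSupp {α : Type*} (M : Matrix α α ℝ) : Matrix α α ℝ :=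
  fun i j => if 0 < M i j then 1 else 0

/-- The matrix `B` with `B e f = 1` iff `t(e) = o(f)`. -/
def Bmat (G : SimpleGraph V) [DecidableRel G.Adj] : Matrix G.Dart G.Dart ℝ :=
  fun e f => if e.toProd.2 = f.toProd.1 then 1 else 0

/-- The arc-inversion matrix `J₀` with `(J₀) e f = 1` iff `f = e⁻¹`. -/
def J0 (G : SimpleGraph V) [DecidableRel G.Adj] : Matrix G.Dart G.Dart ℝ :=
  fun e f => if f = e.symm then 1 else 0

/-- The diagonal degree matrix of `G`. -/
noncomputable def degMat (G : SimpleGraph V) [DecidableRel G.Adj] : Matrix V V ℝ :=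
  Matrix.diagonal fun v => (G.degree v : ℝ)

open Polynomial in
lemma det_blocks_aux (A : Matrix V V ℝ) (p q r s : ℝ[X]) :
    (fromBlocks (aeval A p) (aeval A q) (aeval A r) (aeval A s)).det
      = (aeval A (p * s - q * r)).det := by
  have h := Matrix.det_det (M := !![p, q; r, s]) (f := (aeval A : ℝ[X] →ₐ[ℝ] Matrix V V ℝ).toRingHom)
  rw [Matrix.det_fin_two_of] at h
  have h2 : (aeval A (p * s - q * r)).det = ((aeval A : ℝ[X] →ₐ[ℝ] Matrix V V ℝ).toRingHom (p * s - q * r)).det := rfl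
  rw [h2, h]
  let e : V ⊕ V ≃ Fin 2 × V :=
    ((finTwoEquiv.prodCongr (Equiv.refl V)).trans (Equiv.boolProdEquivSum V)).symm
  rw [← Matrix.det_submatrix_equiv_self e]
  congr 1
  ext i j
  rcases i with i | i <;> rcases j with j | j <;> rfl

section aux
variable (G : SimpleGraph V) [DecidableRel G.Adj]

/-- Origin incidence matrix. -/
def Om : Matrix V G.Dart ℝ := fun v e => if e.toProd.1 = v then 1 else 0
/-- Terminus incidence matrix. -/
def Tm : Matrix V G.Dart ℝ := fun v e => if e.toProd.2 = v then 1 else 0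

lemma J0_mul_J0 : J0 G * J0 G = 1 := by
  ext e f
  simp only [J0, mul_apply, mul_ite, mul_one, mul_zero, Matrix.one_apply]
  rw [Finset.sum_eq_single e.symm] <;> simp +contextual [eq_comm]

lemma J0_transpose : (J0 G)ᵀ = J0 G := by
  ext e f
  simp only [J0, transpose_apply]
  congr 1
  apply propext
  constructor <;> rintro rfl <;> simp

lemma Om_mul_J0 : Om G * J0 G = Tm G := by
  ext v e
  simp only [Om, Tm, J0, mul_apply, mul_ite, mul_one, mul_zero]
  rw [Finset.sum_eq_single e.symm]
  · simp
  · intro b _ hb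
    rw [if_neg]
    rintro rfl
    simp at hb
  · simp

lemma Tm_mul_J0 : Tm G * J0 G = Om G := by
  rw [← Om_mul_J0, Matrix.mul_assoc, J0_mul_J0, Matrix.mul_one]

lemma Om_mul_Tmt : Om G * (Tm G)ᵀ = G.adjMatrix ℝ := by
  ext v w
  simp only [Om, Tm, mul_apply, transpose_apply, mul_ite, mul_one, mul_zero, adjMatrix_apply]
  by_cases h : G.Adj v w
  · rw [Finset.sum_eq_single (⟨(v, w), h⟩ : G.Dart)]
    · simp [h]
    · rintro ⟨⟨a, b⟩, hb⟩ _ hne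
      simp only
      by_cases h1 : b = w
      · by_cases h2 : a = v
        · subst h1 h2; exact absurd rfl hne
        · simp [h2]
      · simp [h1]
    · simp
  · rw [if_neg h]
    apply Finset.sum_eq_zero
    rintro ⟨⟨a, b⟩, hb⟩ _
    simp only
    by_cases h1 : b = w
    · by_cases h2 : a = v
      · subst h1 h2; exact absurd hb h
      · simp [h2]
    · simp [h1]

lemma Tm_mul_Omt : Tm G * (Om G)ᵀ = G.adjMatrix ℝ := by
  have := congrArg transpose (Om_mul_Tmt G)
  simpa [transpose_mul] using this

lemma Om_mul_Omt {k : ℕ} (hreg : G.IsRegularOfDegree k) :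
    Om G * (Om G)ᵀ = (k : ℝ) • (1 : Matrix V V ℝ) := by
  ext v w
  simp only [Om, mul_apply, transpose_apply, mul_ite, mul_one, mul_zero, Matrix.smul_apply,
    Matrix.one_apply, smul_eq_mul]
  by_cases h : v = w
  · subst h
    have h1 := G.dart_fst_fiber_card_eq_degree v
    rw [hreg v] at h1
    rw [if_pos rfl, ← h1, Finset.card_filter]
    push_cast
    refine Finset.sum_congr rfl fun e _ => ?_
    split_ifs <;> simp
  · rw [if_neg h]
    apply Finset.sum_eq_zero
    intro e _
    by_cases h1 : e.toProd.1 = w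
    · have : e.toProd.1 ≠ v := fun h2 => h (h2.symm.trans h1)
      simp [this]
    · simp [h1]

lemma Tm_mul_Tmt {k : ℕ} (hreg : G.IsRegularOfDegree k) :
    Tm G * (Tm G)ᵀ = (k : ℝ) • (1 : Matrix V V ℝ) := by
  rw [← Om_mul_J0, transpose_mul, J0_transpose, Matrix.mul_assoc, ← Matrix.mul_assoc (J0 G),
    J0_mul_J0, Matrix.one_mul, Om_mul_Omt G hreg]

lemma J0_mul_Omt : J0 G * (Om G)ᵀ = (Tm G)ᵀ := by
  rw [← Om_mul_J0, transpose_mul, J0_transpose]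

lemma J0_mul_Tmt : J0 G * (Tm G)ᵀ = (Om G)ᵀ := by
  rw [← Tm_mul_J0, transpose_mul, J0_transpose]

lemma grover_eq {k : ℕ} (hreg : G.IsRegularOfDegree k) :
    grover G = (2 / (k : ℝ)) • ((Om G)ᵀ * Tm G) - J0 G := by
  ext e f
  have h1 : ((Om G)ᵀ * Tm G) e f = if f.toProd.2 = e.toProd.1 then 1 else 0 := by
    simp [Om, Tm, mul_apply, eq_comm]
  rw [Matrix.sub_apply, Matrix.smul_apply, h1]
  simp only [grover, J0, hreg _]
  by_cases h : f = e.symm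
  · subst h; simp
  · simp [h]

lemma grover_cube {k : ℕ} (hreg : G.IsRegularOfDegree k) (hk : k ≠ 0) :
    grover G ^ 3 = (2 / (k : ℝ)) ^ 3 • ((Om G)ᵀ * (G.adjMatrix ℝ ^ 2) * Tm G)
      - (2 / (k : ℝ)) ^ 2 • ((Om G)ᵀ * G.adjMatrix ℝ * Om G + (Tm G)ᵀ * G.adjMatrix ℝ * Tm G)
      + (2 / (k : ℝ)) • ((Tm G)ᵀ * Om G) - J0 G := by
  have hk' : (k : ℝ) ≠ 0 := by exact_mod_cast hk
  rw [grover_eq G hreg]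
  generalize ha : 2 / (k : ℝ) = a
  have hak : a * k = 2 := by rw [← ha]; field_simp
  have h1 : (Om G)ᵀ * Tm G * ((Om G)ᵀ * Tm G) = (Om G)ᵀ * G.adjMatrix ℝ * Tm G := by
    rw [← Tm_mul_Omt]; simp only [Matrix.mul_assoc]
  have h2 : (Om G)ᵀ * Tm G * J0 G = (Om G)ᵀ * Om G := by
    rw [Matrix.mul_assoc, Tm_mul_J0]
  have h3 : J0 G * ((Om G)ᵀ * Tm G) = (Tm G)ᵀ * Tm G := by
    rw [← Matrix.mul_assoc, J0_mul_Omt]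
  have h4 : (a • ((Om G)ᵀ * Tm G) - J0 G) ^ 2
      = a ^ 2 • ((Om G)ᵀ * G.adjMatrix ℝ * Tm G) - a • ((Om G)ᵀ * Om G + (Tm G)ᵀ * Tm G) + 1 := by
    rw [pow_two, Matrix.sub_mul, Matrix.mul_sub, Matrix.mul_sub, J0_mul_J0]
    simp only [Matrix.smul_mul, Matrix.mul_smul, h1, h2, h3]
    module
  have h5 : (Om G)ᵀ * G.adjMatrix ℝ * Tm G * ((Om G)ᵀ * Tm G)
      = (Om G)ᵀ * (G.adjMatrix ℝ ^ 2) * Tm G := by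
    rw [pow_two]; nth_rewrite 3 [← Tm_mul_Omt]; simp only [Matrix.mul_assoc]
  have h6 : (Om G)ᵀ * G.adjMatrix ℝ * Tm G * J0 G = (Om G)ᵀ * G.adjMatrix ℝ * Om G := by
    rw [Matrix.mul_assoc, Tm_mul_J0]
  have h7 : (Om G)ᵀ * Om G * ((Om G)ᵀ * Tm G) = (k : ℝ) • ((Om G)ᵀ * Tm G) := by
    rw [Matrix.mul_assoc, ← Matrix.mul_assoc (Om G), Om_mul_Omt G hreg]; simp
  have h8 : (Tm G)ᵀ * Tm G * ((Om G)ᵀ * Tm G) = (Tm G)ᵀ * G.adjMatrix ℝ * Tm G := by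
    rw [← Tm_mul_Omt]; simp only [Matrix.mul_assoc]
  have h9 : (Om G)ᵀ * Om G * J0 G = (Om G)ᵀ * Tm G := by
    rw [Matrix.mul_assoc, Om_mul_J0]
  have h10 : (Tm G)ᵀ * Tm G * J0 G = (Tm G)ᵀ * Om G := by
    rw [Matrix.mul_assoc, Tm_mul_J0]
  rw [pow_succ, h4]
  simp only [Matrix.sub_mul, Matrix.add_mul, Matrix.mul_sub, Matrix.smul_mul, Matrix.mul_smul,
    h5, h6, h7, h8, h9, h10, Matrix.one_mul, smul_add, smul_sub, smul_smul]
  rw [show a * (a * (k : ℝ)) = 2 * a by rw [hak]; ring]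
  module

lemma c4_free (hg : 4 < G.egirth) {x w p q : V} (hxw : x ≠ w) (h1 : G.Adj x p) (h2 : G.Adj p w)
    (h3 : G.Adj x q) (h4 : G.Adj q w) : p = q := by
  by_contra hpq
  let c : G.Walk x x := .cons h1 (.cons h2 (.cons h4.symm (.cons h3.symm .nil)))
  have hc : c.IsCycle := by
    have a1 := h1.ne
    have a2 := h2.ne
    have a3 := h3.ne
    have a4 := h4.ne
    simp only [c, Walk.cons_isCycle_iff, Walk.cons_isPath_iff, Walk.support_cons,
      Walk.support_nil, Walk.edges_cons, Walk.edges_nil, Walk.IsPath.nil]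
    simp
    grind
  have := egirth_le_length hc
  have h5 : c.length = 4 := rfl
  rw [h5] at this
  exact absurd hg (not_lt.mpr this)

lemma adjsq_ne (hg : 4 < G.egirth) {x w p : V} (hxw : x ≠ w) (h1 : G.Adj x p) (h2 : G.Adj p w) :
    (G.adjMatrix ℝ ^ 2) x w = 1 := by
  rw [pow_two, mul_apply, Finset.sum_eq_single p]
  · simp [h1, h2]
  · intro b _ hb
    simp only [adjMatrix_apply]
    by_cases h3 : G.Adj x b
    · by_cases h4 : G.Adj b w
      · exact absurd (c4_free G hg hxw h3 h4 h1 h2) hb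
      · simp [h4]
    · simp [h3]
  · simp

lemma adjsq_zero {x w : V} (h : ∀ p, G.Adj x p → ¬ G.Adj p w) :
    (G.adjMatrix ℝ ^ 2) x w = 0 := by
  rw [pow_two, mul_apply]
  apply Finset.sum_eq_zero
  intro b _
  simp only [adjMatrix_apply]
  by_cases h3 : G.Adj x b
  · simp [h b h3]
  · simp [h3]

lemma adjsq_self {k : ℕ} (hreg : G.IsRegularOfDegree k) (x : V) :
    (G.adjMatrix ℝ ^ 2) x x = k := by
  rw [pow_two, adjMatrix_mul_self_apply_self, hreg x]

lemma posSupp_cube {k : ℕ} (hreg : G.IsRegularOfDegree k) (hk : 2 < k) (hg : 4 < G.egirth) :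
    posSupp (grover G ^ 3) =
      (Om G)ᵀ * (G.adjMatrix ℝ ^ 2 - (k : ℝ) • 1 + (2 : ℝ) • 1) * Tm G
       - (Om G)ᵀ * G.adjMatrix ℝ * Om G - (Tm G)ᵀ * G.adjMatrix ℝ * Tm G
       + (2 : ℝ) • ((Tm G)ᵀ * Om G) - (2 : ℝ) • J0 G := by
  rw [grover_cube G hreg (by omega)]
  have hk' : (2 : ℝ) < k := by exact_mod_cast hk
  generalize ha : 2 / (k : ℝ) = a
  have hak : a * k = 2 := by rw [← ha]; field_simp
  have ha0 : 0 < a := by rw [← ha]; positivity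
  have ha1 : a < 1 := by rw [← ha, div_lt_one (by linarith)]; exact hk'
  have hOT : ∀ (X : Matrix V V ℝ) e f, ((Om G)ᵀ * X * Tm G) e f = X e.toProd.1 f.toProd.2 := by
    intro X e f; simp [Om, Tm, mul_apply]
  have hOO : ∀ (X : Matrix V V ℝ) e f, ((Om G)ᵀ * X * Om G) e f = X e.toProd.1 f.toProd.1 := by
    intro X e f; simp [Om, mul_apply]
  have hTT : ∀ (X : Matrix V V ℝ) e f, ((Tm G)ᵀ * X * Tm G) e f = X e.toProd.2 f.toProd.2 := by
    intro X e f; simp [Tm, mul_apply]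
  have hTO : ∀ e f, ((Tm G)ᵀ * Om G) e f = if e.toProd.2 = f.toProd.1 then 1 else 0 := by
    intro e f; simp [Om, Tm, mul_apply, eq_comm]
  ext e f
  simp only [posSupp, Matrix.sub_apply, Matrix.add_apply, Matrix.smul_apply, hOT, hOO, hTT, hTO,
    smul_eq_mul, J0, Matrix.one_apply, adjMatrix_apply]
  have hfe : f = e.symm ↔ (f.toProd.1 = e.toProd.2 ∧ f.toProd.2 = e.toProd.1) := by
    rw [SimpleGraph.Dart.ext_iff, Prod.ext_iff]; simp
  simp only [hfe]
  have hxy := e.adj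
  have hzw := f.adj
  generalize e.toProd.1 = x at *
  generalize e.toProd.2 = y at *
  generalize f.toProd.1 = z at *
  generalize f.toProd.2 = w at *
  by_cases hxw : x = w
  · subst hxw
    rw [adjsq_self G hreg]
    have e3 : a ^ 3 * k = 2 * a ^ 2 := by linear_combination a ^ 2 * hak
    by_cases hyz : y = z
    · subst hyz
      simp only [hxy, hxy.symm, if_true, and_self, e3]
      rw [if_neg (by linarith)]
      ring
    · have hzy : z ≠ y := fun h => hyz h.symm
      simp only [hzw.symm, hxy.symm, if_true, if_false, hyz, hzy, false_and, e3]
      rw [if_neg (by linarith)]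
      ring
  · have hwx : w ≠ x := fun h => hxw h.symm
    simp only [hxw, hwx, and_false, if_false]
    by_cases hp : ∃ p, G.Adj x p ∧ G.Adj p w
    · obtain ⟨p, h1, h2⟩ := hp
      rw [adjsq_ne G hg hxw h1 h2]
      have hz : G.Adj x z ↔ z = p :=
        ⟨fun h => c4_free G hg hxw h hzw h1 h2, fun h => h ▸ h1⟩
      have hy : G.Adj y w ↔ y = p :=
        ⟨fun h => c4_free G hg hxw hxy h h1 h2, fun h => h ▸ h2⟩
      simp only [hz, hy]
      by_cases hzp : z = p <;> by_cases hyp : y = p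
      · subst hzp hyp
        simp only [if_true]
        rw [if_pos]
        · ring
        · have : 0 < a * (a - 1) ^ 2 := by
            have : a - 1 ≠ 0 := by linarith
            positivity
          linarith
      · have : y ≠ z := fun h => hyp (h.trans hzp)
        simp only [hzp, hyp, if_true, if_false]
        rw [if_neg]
        · ring
        · have : a ^ 3 < a ^ 2 := by nlinarith [sq_nonneg a, pow_pos ha0 2]
          linarith
      · have : y ≠ z := fun h => hzp (h.symm.trans hyp)
        simp only [hzp, hyp, if_true, if_false]
        rw [if_neg (c := p = z) (fun h => hzp h.symm), if_neg]
        · ring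
        · have : a ^ 3 < a ^ 2 := by nlinarith [sq_nonneg a, pow_pos ha0 2]
          linarith
      · have : y ≠ z := by
          rintro rfl
          exact hzp (c4_free G hg hxw hxy hzw h1 h2)
        simp only [hzp, hyp, this, if_false]
        rw [if_pos]
        · ring
        · have := pow_pos ha0 3
          linarith
    · push Not at hp
      rw [adjsq_zero G hp]
      have hz : ¬ G.Adj x z := fun h => hp z h hzw
      have hy : ¬ G.Adj y w := fun h => hp y hxy h
      have hyz : y ≠ z := by
        rintro rfl
        exact hz hxy
      simp [hz, hy, hyz]

open Polynomial in
lemma det_one_add_smul_J0 (t : ℝ) :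
    (1 + t • J0 G).det = (1 - t ^ 2) ^ G.edgeFinset.card := by
  let J : Matrix G.Dart G.Dart ℝ[X] := (J0 G).map C
  have hJJ : J * J = 1 := by
    simp only [J]
    rw [← Matrix.map_mul, J0_mul_J0]
    simp
  let φ := Fintype.equivFin V
  let s : G.Dart → ℝ[X] := fun e => if φ e.toProd.1 < φ e.toProd.2 then 1 else -1
  have hs : ∀ e, s e * s e = 1 := by
    intro e; simp only [s]; split_ifs <;> ring
  have hs' : ∀ e : G.Dart, s e * s e.symm = -1 := by
    intro e
    have : φ e.toProd.1 ≠ φ e.toProd.2 := fun h => e.adj.ne (φ.injective h)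
    simp only [s, Dart.symm_toProd, Prod.fst_swap, Prod.snd_swap]
    rcases lt_or_gt_of_ne this with h | h
    · simp [h, h.not_gt]
    · simp [h, h.not_gt]
  have hDD : diagonal s * diagonal s = 1 := by
    rw [diagonal_mul_diagonal]; simp [hs]
  have hDJ : diagonal s * J * diagonal s = -J := by
    ext1 e f
    rw [mul_diagonal, diagonal_mul]
    simp only [J, Matrix.map_apply, J0, Matrix.neg_apply]
    by_cases h : f = e.symm
    · subst h
      simp only [if_true, map_one, mul_one, hs']
    · simp [h]
  have hm : Fintype.card G.Dart = 2 * G.edgeFinset.card := G.dart_card_eq_twice_card_edges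
  have h1 : (1 - (X : ℝ[X]) • J).det = (1 + (X : ℝ[X]) • J).det := by
    have : 1 - (X : ℝ[X]) • J = diagonal s * (1 + (X : ℝ[X]) • J) * diagonal s := by
      rw [Matrix.mul_add, Matrix.add_mul, Matrix.mul_one, hDD, Matrix.mul_smul, Matrix.smul_mul,
        hDJ, smul_neg, sub_eq_add_neg]
    rw [this, det_mul, det_mul, mul_comm, ← mul_assoc, ← det_mul, hDD, det_one, one_mul]
  have h2 : (1 + (X : ℝ[X]) • J).det ^ 2 = ((1 - X ^ 2) ^ G.edgeFinset.card) ^ 2 := by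
    have : (1 + (X : ℝ[X]) • J) * (1 - (X : ℝ[X]) • J) = (1 - X ^ 2 : ℝ[X]) • 1 := by
      rw [Matrix.add_mul, Matrix.mul_sub, Matrix.mul_sub]
      simp only [Matrix.mul_smul, Matrix.smul_mul, Matrix.one_mul, Matrix.mul_one, hJJ]
      module
    have h3 := congrArg det this
    rw [det_mul, h1, det_smul, det_one, mul_one, hm] at h3
    rw [pow_two, h3, ← pow_mul, mul_comm]
  have hev : ∀ r : ℝ, eval r (1 + (X : ℝ[X]) • J).det = (1 + r • J0 G).det := by
    intro r
    rw [← coe_evalRingHom, RingHom.map_det]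
    congr 1
    ext e f
    simp [J, Matrix.one_apply, apply_ite]
    exact mul_comm _ _
  rw [← hev t]
  rcases sq_eq_sq_iff_eq_or_eq_neg.mp h2 with h | h
  · rw [h]; simp
  · exfalso
    have h0 := hev 0
    rw [h] at h0
    simp at h0
    norm_num at h0

lemma card_le {k : ℕ} (hreg : G.IsRegularOfDegree k) (hk : 2 < k) :
    Fintype.card V ≤ G.edgeFinset.card := by
  have h := G.sum_degrees_eq_twice_card_edges
  simp only [hreg _, Finset.sum_const, smul_eq_mul, Finset.card_univ] at h
  nlinarith

/-- The right-hand matrix. -/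
noncomputable def Rm (k : ℕ) (u : ℝ) : Matrix V V ℝ :=
  (1 : Matrix V V ℝ)
          - u • ((G.adjMatrix ℝ) ^ 3 - (3 * (k : ℝ) - 4) • G.adjMatrix ℝ)
          + (u ^ 2) • ((G.adjMatrix ℝ) ^ 4 - ((k : ℝ) ^ 2) • (G.adjMatrix ℝ) ^ 2
              + (2 * ((k : ℝ) - 1) * ((k : ℝ) ^ 2 - 2 * (k : ℝ) + 2)) •
                  (1 : Matrix V V ℝ))

open Polynomial in
lemma main_ne (k : ℕ) (hreg : G.IsRegularOfDegree k) (hk : 2 < k)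
    (hg : 4 < G.egirth) (u : ℝ) (hc : 1 - 4 * u ^ 2 ≠ 0) :
    Matrix.det ((1 : Matrix G.Dart G.Dart ℝ) - u • posSupp ((grover G) ^ 3)) =
      (1 - 4 * u ^ 2) ^ (G.edgeFinset.card - Fintype.card V) * (Rm G k u).det := by
  obtain ⟨d, hd⟩ : ∃ d, d = (1 - 4 * u ^ 2)⁻¹ := ⟨_, rfl⟩
  have hdc : d * (1 - 4 * u ^ 2) = 1 := by rw [hd]; exact inv_mul_cancel₀ hc
  let A := G.adjMatrix ℝ
  let Q : Matrix V V ℝ := A ^ 2 - (k : ℝ) • 1 + (2 : ℝ) • 1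
  let W : Matrix (V ⊕ V) G.Dart ℝ := fromRows (Om G) (Tm G)
  let M : Matrix (V ⊕ V) (V ⊕ V) ℝ := fromBlocks (-A) Q ((2 : ℝ) • 1) (-A)
  have hF : posSupp (grover G ^ 3) = Wᵀ * M * W - (2 : ℝ) • J0 G := by
    rw [posSupp_cube G hreg hk hg]
    congr 1
    simp only [W, M, transpose_fromRows, fromCols_mul_fromBlocks, fromCols_mul_fromRows, Q, A]
    simp only [Matrix.add_mul, Matrix.mul_neg, Matrix.neg_mul, Matrix.mul_smul, Matrix.smul_mul, Matrix.mul_one]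
    abel
  have hN : W * ((1 - (2 * u) • J0 G) * Wᵀ) =
      fromBlocks ((k : ℝ) • 1 - (2 * u) • A) (A - (2 * u) • (k : ℝ) • 1)
        (A - (2 * u) • (k : ℝ) • 1) ((k : ℝ) • 1 - (2 * u) • A) := by
    simp only [W, transpose_fromRows, mul_fromCols, fromRows_mul, Matrix.sub_mul, Matrix.smul_mul,
      J0_mul_Omt, J0_mul_Tmt, Matrix.mul_sub, Matrix.mul_smul, Matrix.one_mul, Om_mul_Omt G hreg,
      Om_mul_Tmt, Tm_mul_Omt, Tm_mul_Tmt G hreg, A, fromCols_fromRows_eq_fromBlocks]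
    ext (i | i) (j | j) <;> simp
  have h1 : (1 : Matrix G.Dart G.Dart ℝ) - u • posSupp ((grover G) ^ 3)
      = (1 + (2 * u) • J0 G) * (1 - (d * u) • ((1 - (2 * u) • J0 G) * Wᵀ) * (M * W)) := by
    have h2 : (1 + (2 * u) • J0 G) * (1 - (2 * u) • J0 G) = (1 - 4 * u ^ 2) • 1 := by
      rw [Matrix.add_mul, Matrix.mul_sub, Matrix.mul_sub]
      simp only [Matrix.mul_smul, Matrix.smul_mul, Matrix.one_mul, Matrix.mul_one, J0_mul_J0]
      module
    rw [Matrix.mul_sub, Matrix.mul_one, Matrix.smul_mul, Matrix.mul_smul, Matrix.mul_assoc (1 - (2 * u) • J0 G),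
      ← Matrix.mul_assoc (1 + (2 * u) • J0 G), h2, hF, Matrix.smul_mul, smul_smul,
      show d * u * (1 - 4 * u ^ 2) = u by linear_combination u * hdc, Matrix.one_mul,
      ← Matrix.mul_assoc]
    module
  rw [h1, det_mul, det_one_add_smul_J0, det_one_sub_mul_comm, Matrix.mul_assoc, Matrix.mul_smul, hN]
  let al : ℝ[X] := C (k : ℝ) - C (2 * u) * X
  let be : ℝ[X] := X - C (2 * u) * C (k : ℝ)
  let q : ℝ[X] := X ^ 2 - C (k : ℝ) + C 2
  have h3 : 1 - M * (d * u) • fromBlocks ((k : ℝ) • 1 - (2 * u) • A) (A - (2 * u) • (k : ℝ) • 1)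
        (A - (2 * u) • (k : ℝ) • 1) ((k : ℝ) • 1 - (2 * u) • A)
      = fromBlocks (aeval A (1 - C (d * u) * (-X * al + q * be)))
          (aeval A (- (C (d * u) * (-X * be + q * al))))
          (aeval A (- (C (d * u) * (C 2 * al - X * be))))
          (aeval A (1 - C (d * u) * (C 2 * be - X * al))) := by
    rw [← fromBlocks_one, fromBlocks_smul, fromBlocks_multiply]
    simp only [sub_eq_add_neg, fromBlocks_neg, fromBlocks_add]
    simp only [al, be, q, Q, map_add, map_sub, map_neg, map_mul, map_one, map_pow, aeval_X, aeval_C,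
      Algebra.algebraMap_eq_smul_one, Matrix.smul_mul, Matrix.mul_smul, Matrix.one_mul,
      smul_add, smul_sub, smul_neg, Matrix.mul_add, Matrix.add_mul, Matrix.mul_sub, Matrix.sub_mul, Matrix.mul_neg, Matrix.neg_mul, Matrix.mul_one]
    congr 1 <;> module
  rw [h3, det_blocks_aux]
  have h4 : aeval A ((1 - C (d * u) * (-X * al + q * be)) * (1 - C (d * u) * (C 2 * be - X * al))
      - (- (C (d * u) * (-X * be + q * al))) * (- (C (d * u) * (C 2 * al - X * be)))) =
      d • Rm G k u := by
    have h5 : (1 - C (d * u) * (-X * al + q * be)) * (1 - C (d * u) * (C 2 * be - X * al))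
      - (- (C (d * u) * (-X * be + q * al))) * (- (C (d * u) * (C 2 * al - X * be)))
       = C d * (1 - C u * (X ^ 3 - C (3 * (k : ℝ) - 4) * X) + C (u ^ 2) * (X ^ 4 - C ((k : ℝ) ^ 2) * X ^ 2
         + C (2 * ((k : ℝ) - 1) * ((k : ℝ) ^ 2 - 2 * (k : ℝ) + 2)))) := by
      have hdC : C d * (1 - 4 * C u ^ 2) = 1 := by
        have := congrArg (C : ℝ →+* ℝ[X]) hdc
        simpa only [map_mul, map_sub, map_pow, map_one, map_ofNat] using this
      simp only [al, be, q, map_mul, map_sub, map_add, map_pow, map_one, map_ofNat]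
      generalize C d = D at *
      generalize C u = U at *
      generalize C (k : ℝ) = K at *
      linear_combination (D * U ^ 2 * (2 * K - 4 - X ^ 2) * (K ^ 2 - X ^ 2) - 1) * hdC
    rw [h5]
    unfold Rm
    generalize 2 * ((k : ℝ) - 1) * ((k : ℝ) ^ 2 - 2 * (k : ℝ) + 2) = a3
    generalize 3 * (k : ℝ) - 4 = a1
    generalize (k : ℝ) ^ 2 = a2
    generalize u ^ 2 = b
    simp only [ map_add, map_sub, map_mul, map_one, map_pow, aeval_X, aeval_C,
      Algebra.algebraMap_eq_smul_one, Matrix.smul_mul, Matrix.one_mul, A]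
  rw [h4, det_smul, show (2 * u) ^ 2 = 4 * u ^ 2 by ring, pow_sub₀ _ hc (card_le G hreg hk), hd, inv_pow]
  ring

end aux

/-- Theorem 5.2: for a connected `k`-regular graph with `k > 2` and girth
`> 4`, the reciprocal of the 3-modified zeta function is
`(1-4u²)^{m-n} det(I_n - u(A³-(3k-4)A) + u²(A⁴ - k²A² + 2(k-1)(k²-2k+2) I_n))`. -/
theorem det_posSupp_grover_cube_regular (G : SimpleGraph V) [DecidableRel G.Adj] (k : ℕ)
    (hconn : G.Connected) (hreg : G.IsRegularOfDegree k) (hk : 2 < k)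
    (hg : 4 < G.egirth) (u : ℝ) :
    Matrix.det ((1 : Matrix G.Dart G.Dart ℝ) - u • posSupp ((grover G) ^ 3)) =
      (1 - 4 * u ^ 2) ^ (G.edgeFinset.card - Fintype.card V) *
        Matrix.det ((1 : Matrix V V ℝ)
          - u • ((G.adjMatrix ℝ) ^ 3 - (3 * (k : ℝ) - 4) • G.adjMatrix ℝ)
          + (u ^ 2) • ((G.adjMatrix ℝ) ^ 4 - ((k : ℝ) ^ 2) • (G.adjMatrix ℝ) ^ 2
              + (2 * ((k : ℝ) - 1) * ((k : ℝ) ^ 2 - 2 * (k : ℝ) + 2)) •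
                  (1 : Matrix V V ℝ))) := by
  have hL : Continuous fun u : ℝ =>
      Matrix.det ((1 : Matrix G.Dart G.Dart ℝ) - u • posSupp ((grover G) ^ 3)) := by
    apply Continuous.matrix_det
    fun_prop
  have hR : Continuous fun u : ℝ =>
      (1 - 4 * u ^ 2) ^ (G.edgeFinset.card - Fintype.card V) * (Rm G k u).det := by
    apply Continuous.mul
    · fun_prop
    · apply Continuous.matrix_det
      unfold Rm
      fun_prop
  have hdense : Dense (({1 / 2, -1 / 2} : Set ℝ)ᶜ) :=
    (Set.toFinite _).countable.dense_compl ℝ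
  have := Continuous.ext_on hdense hL hR (by
    intro v hv
    apply main_ne G k hreg hk hg v
    intro h
    apply hv
    have : (v - 1 / 2) * (v + 1 / 2) = 0 := by linarith
    rcases mul_eq_zero.mp this with h | h
    · left; linarith
    · right; simp only [Set.mem_singleton_iff]; linarith)
  exact congrFun this u
end

section
/- Let G be a connected k-regular finite simple graph with n vertices and m edges, where k > 2 and the girth g(G) > 4. If λ_A ∈ ℂ is an eigenvalue of the adjacency matrix A(G) and μ ∈ ℂ satisfies μ² − (λ_A³ − (3k−4)λ_A)·μ + (λ_A⁴ − k²·λ_A² + 2(k−1)(k²−2k+2)) = 0, then μ is an eigenvalue of (U³)⁺ (viewed as a complex matrix). Moreover, if m > n then 2 and −2 are eigenvalues of (U³)⁺, each with algebraic multiplicity at least m − n. -/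
open Matrix SimpleGraph

variable {V : Type*} [Fintype V] [DecidableEq V]

section Aux

/-- Generic dart transition matrix with weight `q` on backtracking and `p` otherwise. -/
def Pm {R : Type*} [CommRing R] (G : SimpleGraph V) (p q : R) : Matrix G.Dart G.Dart R :=
  fun e f => if f.toProd.2 = e.toProd.1 then (if f.toProd.1 = e.toProd.2 then q else p) else 0

lemma dart_sum {R : Type*} [AddCommMonoid R] (G : SimpleGraph V) [DecidableRel G.Adj]
    (g : V → V → R) :
    ∑ d : G.Dart, g d.toProd.1 d.toProd.2 = ∑ x, ∑ y, if G.Adj x y then g x y else 0 := by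
  rw [← Fintype.sum_prod_type' (f := fun x y => if G.Adj x y then g x y else 0),
    ← Finset.sum_filter (fun a : V × V => G.Adj a.1 a.2) (fun a => g a.1 a.2)]
  refine Finset.sum_bij (fun d _ => d.toProd) ?_ ?_ ?_ ?_
  · intro d _; simpa using d.adj
  · intro a _ b _ h; exact SimpleGraph.Dart.ext _ _ h
  · intro b hb
    exact ⟨⟨b, by simpa using hb⟩, Finset.mem_univ _, rfl⟩
  · intro d _; rfl

lemma Pm_sq {R : Type*} [CommRing R] (G : SimpleGraph V) [DecidableRel G.Adj] (p q : R)
    (e a : G.Dart) :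
    (Pm G p q * Pm G p q) e a = if G.Adj a.toProd.2 e.toProd.1 then
      (if a.toProd.2 = e.toProd.2 then q else p) * (if a.toProd.1 = e.toProd.1 then q else p)
      else 0 := by
  simp only [Matrix.mul_apply, Pm]
  rw [dart_sum G (fun x y => (if y = e.toProd.1 then (if x = e.toProd.2 then q else p) else 0) *
    (if a.toProd.2 = x then (if a.toProd.1 = y then q else p) else 0))]
  rw [Finset.sum_eq_single a.toProd.2, Finset.sum_eq_single e.toProd.1]
  · simp
  · intro b _ hb; simp [hb]
  · simp
  · intro b _ hb; simp [hb.symm]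
  · simp

lemma Pm_cube {R : Type*} [CommRing R] (G : SimpleGraph V) [DecidableRel G.Adj] (p q : R)
    (e f : G.Dart) :
    ((Pm G p q) ^ 3) e f = ∑ w, if G.Adj f.toProd.2 w ∧ G.Adj w e.toProd.1 then
      (if w = e.toProd.2 then q else p) * (if f.toProd.2 = e.toProd.1 then q else p) *
      (if w = f.toProd.1 then q else p) else 0 := by
  rw [pow_succ, pow_two, Matrix.mul_apply]
  simp only [Pm_sq]
  simp only [Pm]
  rw [dart_sum G (fun x y => (if G.Adj y e.toProd.1 then
      (if y = e.toProd.2 then q else p) * (if x = e.toProd.1 then q else p) else 0) *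
      (if f.toProd.2 = x then (if f.toProd.1 = y then q else p) else 0))]
  rw [Finset.sum_eq_single f.toProd.2]
  · refine Finset.sum_congr rfl fun w _ => ?_
    by_cases h1 : G.Adj f.toProd.2 w <;> by_cases h2 : G.Adj w e.toProd.1 <;>
      simp [h1, h2, eq_comm]
  · intro b _ hb; simp [hb.symm]
  · simp

lemma grover_eq_s11 (G : SimpleGraph V) [DecidableRel G.Adj] (k : ℕ)
    (hreg : G.IsRegularOfDegree k) : grover G = Pm G (2 / (k : ℝ)) (2 / (k : ℝ) - 1) := by
  ext e f
  simp only [grover, Pm, hreg.degree_eq]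
  have : f = e.symm ↔ f.toProd.2 = e.toProd.1 ∧ f.toProd.1 = e.toProd.2 := by
    rw [SimpleGraph.Dart.ext_iff, Prod.ext_iff]; simp [and_comm]
  by_cases h1 : f.toProd.2 = e.toProd.1 <;> by_cases h2 : f.toProd.1 = e.toProd.2 <;>
    simp [this, h1, h2]

lemma common_unique (G : SimpleGraph V) (hg : 4 < G.egirth) {v x w w' : V} (hvx : v ≠ x)
    (h1 : G.Adj v w) (h2 : G.Adj w x) (h3 : G.Adj v w') (h4 : G.Adj w' x) : w = w' := by
  by_contra hne
  let c : G.Walk v v := .cons h1 (.cons h2 (.cons h4.symm (.cons h3.symm .nil)))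
  have hc : c.IsCycle := by
    have := h1.ne
    have := h2.ne
    have := h3.ne
    have := h4.ne
    simp only [c, SimpleGraph.Walk.cons_isCycle_iff]
    simp
    grind
  have := SimpleGraph.egirth_le_length hc
  have h5 : (4 : ℕ∞) < 4 := lt_of_lt_of_le hg this
  exact lt_irrefl _ h5

lemma posSupp_eq (G : SimpleGraph V) [DecidableRel G.Adj] (k : ℕ)
    (hreg : G.IsRegularOfDegree k) (hk : 2 < k) (hg : 4 < G.egirth) :
    (posSupp ((grover G) ^ 3)).map (fun x : ℝ => (x : ℂ)) =
      (Pm G (1 : ℂ) 0) ^ 3 + (Pm G (1 : ℂ) 0)ᵀ := by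
  have hk' : (2 : ℝ) < k := by exact_mod_cast hk
  have hp : 0 < 2 / (k : ℝ) := by positivity
  have hq : 2 / (k : ℝ) - 1 < 0 := by
    rw [sub_neg, div_lt_one (by linarith)]; exact hk'
  have hpk : (k : ℝ) * (2 / k) = 2 := by field_simp
  rw [grover_eq_s11 G k hreg]
  ext e f
  simp only [Matrix.map_apply, posSupp, Matrix.add_apply, Matrix.transpose_apply, Pm_cube]
  generalize (2 / (k : ℝ)) = p at *
  obtain ⟨⟨x, y⟩, hxy⟩ := e
  obtain ⟨⟨u, v⟩, huv⟩ := f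
  simp only [Pm]
  simp only at hxy huv
  by_cases hvx : v = x
  · subst hvx
    have hs : (∑ w, if G.Adj v w ∧ G.Adj w v then
        (if w = y then p - 1 else p) * (if v = v then p - 1 else p) *
        (if w = u then p - 1 else p) else 0) ≤ 0 := by
      have : ∀ w, (if G.Adj v w ∧ G.Adj w v then
        (if w = y then p - 1 else p) * (if v = v then p - 1 else p) *
        (if w = u then p - 1 else p) else 0) = (p - 1) * ((if G.Adj v w then p * p else 0)
          - (if w = y then p else 0) - (if w = u then p else 0)
          + (if w = y then (if y = u then 1 else 0) else 0)) := by
        intro w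
        have hu := huv.symm
        by_cases h : G.Adj v w
        · by_cases h1 : w = y
          · subst h1
            by_cases h2 : w = u
            · simp [h, h.symm, h2, hu, hu.symm]; ring
            · simp [h, h.symm, h2]; ring
          · by_cases h2 : w = u
            · simp [h, h.symm, h1, h2, hu, hu.symm]; grind
            · simp [h, h.symm, h1, h2]; ring
        · have h1 : w ≠ y := by rintro rfl; exact h hxy
          have h2 : w ≠ u := by rintro rfl; exact h hu
          simp [h, h1, h2]
      rw [Finset.sum_congr rfl (fun w _ => this w), ← Finset.mul_sum]
      simp only [Finset.sum_add_distrib, Finset.sum_sub_distrib, Finset.sum_ite_eq',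
        Finset.mem_univ, if_true]
      rw [← Finset.sum_filter, Finset.sum_const, ← SimpleGraph.neighborFinset_eq_filter,
        SimpleGraph.card_neighborFinset_eq_degree, hreg.degree_eq, nsmul_eq_mul]
      have h0 : (k : ℝ) * (p * p) = 2 * p := by rw [← mul_assoc, hpk]
      rw [h0]
      split_ifs <;> nlinarith
    rw [if_neg (not_lt.mpr hs)]
    by_cases h : y = u <;> simp [h]
  · have hadj : ∀ {R : Type} [CommRing R] (a b : R), ∀ w₀, G.Adj v w₀ → G.Adj w₀ x →
      (∑ w, if G.Adj v w ∧ G.Adj w x then (if w = y then b else a) *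
        (if v = x then b else a) * (if w = u then b else a) else 0) =
        (if w₀ = y then b else a) * a * (if w₀ = u then b else a) := by
      intro R _ a b w₀ h1 h2
      rw [Finset.sum_eq_single w₀]
      · simp [h1, h2, hvx]
      · intro w _ hw
        rw [if_neg]
        rintro ⟨h3, h4⟩
        exact hw (common_unique G hg hvx h3 h4 h1 h2)
      · simp
    by_cases hex : ∃ w, G.Adj v w ∧ G.Adj w x
    · obtain ⟨w, h1, h2⟩ := hex
      rw [hadj _ _ w h1 h2, hadj _ _ w h1 h2]
      have hyu : y = u → w = u := by
        rintro rfl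
        exact common_unique G hg hvx h1 h2 huv.symm hxy.symm
      have hvx' : ¬ x = v := fun h => hvx h.symm
      by_cases h3 : w = y
      · by_cases h4 : w = u
        · have hpos : 0 < (p - 1) * p * (p - 1) := by nlinarith [mul_pos_of_neg_of_neg hq hq]
          subst h3
          simp [h4, hvx'] at hpos ⊢
          exact hpos
        · have hneg : ¬ 0 < (p - 1) * p * p := by nlinarith [mul_pos hp hp]
          have h5 : ¬ y = u := fun h => h4 (hyu h)
          subst h3
          simp [h4] at hneg ⊢
          exact hneg
      · by_cases h4 : w = u
        · have hneg : ¬ 0 < p * p * (p - 1) := by nlinarith [mul_pos hp hp]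
          have h5 : ¬ y = u := fun h => h3 (h4.trans h.symm)
          have h6 : ¬ u = y := fun h => h5 h.symm
          subst h4
          simp [h5, h6] at hneg ⊢
          exact hneg
        · have h5 : ¬ y = u := fun h => h4 (hyu h)
          simp [h3, h4, h5, hp]
    · have hz : ∀ {R : Type} [CommRing R] (a b : R),
        (∑ w, if G.Adj v w ∧ G.Adj w x then (if w = y then b else a) *
        (if v = x then b else a) * (if w = u then b else a) else 0) = 0 := by
        intro R _ a b
        refine Finset.sum_eq_zero fun w _ => if_neg fun h => hex ⟨w, h⟩
      rw [hz, hz]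
      have h5 : ¬ y = u := by
        rintro rfl; exact hex ⟨y, huv.symm, hxy.symm⟩
      simp [h5]

lemma N_mulVec (G : SimpleGraph V) [DecidableRel G.Adj] (h : G.Dart → ℂ) (e : G.Dart) :
    (Pm G (1 : ℂ) 0 *ᵥ h) e =
      (∑ f : G.Dart, if f.toProd.2 = e.toProd.1 then h f else 0) - h e.symm := by
  have : h e.symm = ∑ f : G.Dart, if f = e.symm then h f else 0 := by simp
  rw [this, ← Finset.sum_sub_distrib]
  simp only [Matrix.mulVec, dotProduct, Pm]
  refine Finset.sum_congr rfl fun f _ => ?_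
  have : f = e.symm ↔ f.toProd.2 = e.toProd.1 ∧ f.toProd.1 = e.toProd.2 := by
    rw [SimpleGraph.Dart.ext_iff, Prod.ext_iff]; simp [and_comm]
  by_cases h1 : f.toProd.2 = e.toProd.1 <;> by_cases h2 : f.toProd.1 = e.toProd.2 <;>
    simp [this, h1, h2]

lemma NT_mulVec (G : SimpleGraph V) [DecidableRel G.Adj] (h : G.Dart → ℂ) (e : G.Dart) :
    ((Pm G (1 : ℂ) 0)ᵀ *ᵥ h) e =
      (∑ f : G.Dart, if f.toProd.1 = e.toProd.2 then h f else 0) - h e.symm := by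
  have : h e.symm = ∑ f : G.Dart, if f = e.symm then h f else 0 := by simp
  rw [this, ← Finset.sum_sub_distrib]
  simp only [Matrix.mulVec, dotProduct, Pm, Matrix.transpose_apply]
  refine Finset.sum_congr rfl fun f _ => ?_
  have : f = e.symm ↔ e.toProd.2 = f.toProd.1 ∧ e.toProd.1 = f.toProd.2 := by
    rw [SimpleGraph.Dart.ext_iff, Prod.ext_iff]; simp [eq_comm]
  by_cases h1 : e.toProd.2 = f.toProd.1 <;> by_cases h2 : e.toProd.1 = f.toProd.2 <;>
    simp [this, h1, h2, eq_comm (a := f.toProd.1)]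

/-- Functions on darts depending on the origin. -/
def Kf (G : SimpleGraph V) (φ : V → ℂ) : G.Dart → ℂ := fun e => φ e.toProd.1
/-- Functions on darts depending on the terminus. -/
def Lf (G : SimpleGraph V) (φ : V → ℂ) : G.Dart → ℂ := fun e => φ e.toProd.2

section
variable (G : SimpleGraph V) [DecidableRel G.Adj] (k : ℕ)

lemma sum_adj_const (hreg : G.IsRegularOfDegree k) (v : V) (c : ℂ) :
    (∑ y, if G.Adj v y then c else 0) = k * c := by
  rw [← Finset.sum_filter, Finset.sum_const, ← SimpleGraph.neighborFinset_eq_filter,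
        SimpleGraph.card_neighborFinset_eq_degree, hreg.degree_eq, nsmul_eq_mul]

lemma sum_into (g : V → V → ℂ) (v : V) :
    (∑ f : G.Dart, if f.toProd.2 = v then g f.toProd.1 f.toProd.2 else 0) =
      ∑ u, if G.Adj v u then g u v else 0 := by
  rw [dart_sum G (fun x y => if y = v then g x y else 0)]
  refine Finset.sum_congr rfl fun u _ => ?_
  rw [Finset.sum_eq_single v]
  · simp [G.adj_comm]
  · intro b _ hb; simp [hb]
  · simp

lemma sum_out (g : V → V → ℂ) (v : V) :
    (∑ f : G.Dart, if f.toProd.1 = v then g f.toProd.1 f.toProd.2 else 0) =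
      ∑ u, if G.Adj v u then g v u else 0 := by
  rw [dart_sum G (fun x y => if x = v then g x y else 0)]
  rw [Finset.sum_eq_single v]
  · simp
  · intro b _ hb; simp [hb]
  · simp

lemma sum_adj (φ : V → ℂ) (lam : ℂ) (hφ : G.adjMatrix ℂ *ᵥ φ = lam • φ) (v : V) :
    (∑ u, if G.Adj v u then φ u else 0) = lam * φ v := by
  have := congrFun hφ v
  simpa [Matrix.mulVec, dotProduct, SimpleGraph.adjMatrix_apply] using this

lemma N_K (φ : V → ℂ) (lam : ℂ) (hφ : G.adjMatrix ℂ *ᵥ φ = lam • φ) :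
    Pm G (1 : ℂ) 0 *ᵥ Kf G φ = lam • Kf G φ - Lf G φ := by
  ext e
  rw [N_mulVec]
  simp only [Kf, Lf, Pi.sub_apply, Pi.smul_apply, smul_eq_mul]
  rw [sum_into G (fun x _ => φ x), sum_adj G φ lam hφ]; simp

lemma N_L (hreg : G.IsRegularOfDegree k) (φ : V → ℂ) :
    Pm G (1 : ℂ) 0 *ᵥ Lf G φ = ((k : ℂ) - 1) • Kf G φ := by
  ext e
  rw [N_mulVec]
  simp only [Kf, Lf, Pi.smul_apply, smul_eq_mul]
  rw [sum_into G (fun _ x => φ x), sum_adj_const G k hreg]; simp; ring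

lemma NT_K (hreg : G.IsRegularOfDegree k) (φ : V → ℂ) :
    (Pm G (1 : ℂ) 0)ᵀ *ᵥ Kf G φ = ((k : ℂ) - 1) • Lf G φ := by
  ext e
  rw [NT_mulVec]
  simp only [Kf, Lf, Pi.smul_apply, smul_eq_mul]
  rw [sum_out G (fun x _ => φ x), sum_adj_const G k hreg]; simp; ring

lemma NT_L (φ : V → ℂ) (lam : ℂ) (hφ : G.adjMatrix ℂ *ᵥ φ = lam • φ) :
    (Pm G (1 : ℂ) 0)ᵀ *ᵥ Lf G φ = lam • Lf G φ - Kf G φ := by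
  ext e
  rw [NT_mulVec]
  simp only [Kf, Lf, Pi.sub_apply, Pi.smul_apply, smul_eq_mul]
  rw [sum_out G (fun _ x => φ x), sum_adj G φ lam hφ]; simp

lemma M_comb (hreg : G.IsRegularOfDegree k) (φ : V → ℂ) (lam : ℂ)
    (hφ : G.adjMatrix ℂ *ᵥ φ = lam • φ) (a b : ℂ) :
    (((Pm G (1 : ℂ) 0) ^ 3 + (Pm G (1 : ℂ) 0)ᵀ) *ᵥ (a • Kf G φ + b • Lf G φ)) =
      (a * (lam ^ 3 - 2 * ((k : ℂ) - 1) * lam) +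
        b * (((k : ℂ) - 1) * (lam ^ 2 - k + 1) - 1)) • Kf G φ +
      (a * (-lam ^ 2 + 2 * ((k : ℂ) - 1)) + b * (-((k : ℂ) - 2) * lam)) • Lf G φ := by
  have h1 := N_K G φ lam hφ
  have h2 := N_L G k hreg φ
  have h3 := NT_K G k hreg φ
  have h4 := NT_L G φ lam hφ
  rw [Matrix.add_mulVec, pow_succ, pow_two, ← Matrix.mulVec_mulVec, ← Matrix.mulVec_mulVec]
  simp only [Matrix.mulVec_add, Matrix.mulVec_sub, Matrix.mulVec_smul, h1, h2, h3, h4]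
  module

lemma M_eig (h : G.Dart → ℂ) (s : ℂ) (hs : s * s = 1)
    (hJ : ∀ d : G.Dart, h d.symm = -s * h d)
    (h0 : ∀ v, (∑ f : G.Dart, if f.toProd.2 = v then h f else 0) = 0) :
    (((Pm G (1 : ℂ) 0) ^ 3 + (Pm G (1 : ℂ) 0)ᵀ) *ᵥ h) = (2 * s) • h := by
  have h1 : Pm G (1 : ℂ) 0 *ᵥ h = s • h := by
    ext e
    rw [N_mulVec, h0, hJ]; simp
  have h0' : ∀ v, (∑ f : G.Dart, if f.toProd.1 = v then h f else 0) = 0 := by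
    intro v
    have : (∑ f : G.Dart, if f.toProd.1 = v then h f else 0) =
        ∑ f : G.Dart, if f.toProd.2 = v then h f.symm else 0 := by
      refine Finset.sum_bij (fun d _ => d.symm) ?_ ?_ ?_ ?_
      · simp
      · intro a _ b _ hab; exact SimpleGraph.Dart.symm_involutive.injective hab
      · intro b _; exact ⟨b.symm, by simp, by simp⟩
      · intro a _; simp
    rw [this]
    simp only [hJ]
    have : ∀ f : G.Dart, (if f.toProd.2 = v then -s * h f else 0) =
        -s * (if f.toProd.2 = v then h f else 0) := by intro f; split_ifs <;> simp
    simp only [this]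
    rw [← Finset.mul_sum, h0]; simp
  have h2 : (Pm G (1 : ℂ) 0)ᵀ *ᵥ h = s • h := by
    ext e
    rw [NT_mulVec, h0', hJ]; simp
  rw [Matrix.add_mulVec, pow_succ, pow_two, ← Matrix.mulVec_mulVec, ← Matrix.mulVec_mulVec]
  simp only [Matrix.mulVec_smul, h1, h2, smul_smul, hs]
  module

lemma finrank_eig (s : ℂ) (hs : s * s = 1) :
    G.edgeFinset.card - Fintype.card V ≤ Module.finrank ℂ
      (Module.End.eigenspace
        (Matrix.toLin' ((Pm G (1 : ℂ) 0) ^ 3 + (Pm G (1 : ℂ) 0)ᵀ)) (2 * s)) := by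
  have hd : ∀ e : G.edgeSet, ∃ d : G.Dart, d.edge = e := by
    rintro ⟨e, he⟩
    induction e with
    | _ x y => exact ⟨⟨(x, y), he⟩, rfl⟩
  choose δ hδ using hd
  let T : (G.Dart → ℂ) →ₗ[ℂ] (G.edgeSet → ℂ) × (V → ℂ) :=
    { toFun := fun h => (fun e => h (δ e).symm + s * h (δ e),
        fun v => ∑ f : G.Dart, if f.toProd.2 = v then h f else 0)
      map_add' := by
        intro a b
        ext i
        · simp; ring
        · simp only [Pi.add_apply, Prod.snd_add, ← Finset.sum_add_distrib]
          refine Finset.sum_congr rfl fun f _ => ?_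
          split_ifs <;> simp
      map_smul' := by
        intro a b
        ext i
        · simp; ring
        · simp [Finset.mul_sum] }
  have hker : LinearMap.ker T ≤ Module.End.eigenspace
        (Matrix.toLin' ((Pm G (1 : ℂ) 0) ^ 3 + (Pm G (1 : ℂ) 0)ᵀ)) (2 * s) := by
    intro h hh
    rw [LinearMap.mem_ker] at hh
    have hA : ∀ e, h (δ e).symm + s * h (δ e) = 0 := fun e => congrFun (congrArg Prod.fst hh) e
    have hB : ∀ v, (∑ f : G.Dart, if f.toProd.2 = v then h f else 0) = 0 :=
      fun v => congrFun (congrArg Prod.snd hh) v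
    rw [Module.End.mem_eigenspace_iff, Matrix.toLin'_apply]
    refine M_eig G h s hs ?_ hB
    intro d
    have h1 := hA ⟨d.edge, d.edge_mem⟩
    have h2 := hδ ⟨d.edge, d.edge_mem⟩
    rcases (SimpleGraph.dart_edge_eq_iff _ _).1 h2 with h3 | h3
    · rw [h3] at h1; linear_combination h1
    · rw [h3, SimpleGraph.Dart.symm_symm] at h1
      linear_combination s * h1 - h d.symm * hs
  refine le_trans ?_ (Submodule.finrank_mono hker)
  have h1 := LinearMap.finrank_range_add_finrank_ker T
  have h2 := Submodule.finrank_le (LinearMap.range T)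
  rw [Module.finrank_fintype_fun_eq_card, G.dart_card_eq_twice_card_edges] at h1
  rw [Module.finrank_prod, Module.finrank_fintype_fun_eq_card,
    Module.finrank_fintype_fun_eq_card, ← SimpleGraph.edgeFinset_card] at h2
  omega

lemma det_of_eig {α : Type*} [Fintype α] [DecidableEq α] (M : Matrix α α ℂ) (mu : ℂ)
    (h : α → ℂ) (h0 : h ≠ 0) (hM : M *ᵥ h = mu • h) :
    Matrix.det (mu • (1 : Matrix α α ℂ) - M) = 0 := by
  rw [← Matrix.exists_mulVec_eq_zero_iff]
  exact ⟨h, h0, by rw [Matrix.sub_mulVec, hM, Matrix.smul_mulVec, Matrix.one_mulVec, sub_self]⟩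

lemma dvd_charpoly_of {α : Type*} [Fintype α] [DecidableEq α] (M : Matrix α α ℂ) (mu : ℂ) (r : ℕ)
    (h : r ≤ Module.finrank ℂ (Module.End.eigenspace (Matrix.toLin' M) mu)) :
    (Polynomial.X - Polynomial.C mu) ^ r ∣ M.charpoly := by
  rw [← Polynomial.le_rootMultiplicity_iff (Matrix.charpoly_monic M).ne_zero]
  refine h.trans ?_
  have := LinearMap.finrank_eigenspace_le (Matrix.toLin' M) mu
  rwa [Matrix.charpoly_toLin'] at this

lemma det_two (hreg : G.IsRegularOfDegree k) (hk : 2 < k) [Nonempty V]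
    (s : ℂ) (hs : s * s = 1) :
    Matrix.det ((2 * s) • (1 : Matrix G.Dart G.Dart ℂ) -
      ((Pm G (1 : ℂ) 0) ^ 3 + (Pm G (1 : ℂ) 0)ᵀ)) = 0 := by
  have h1 := finrank_eig G s hs
  have h2 := G.sum_degrees_eq_twice_card_edges
  simp only [hreg.degree_eq, Finset.sum_const, Finset.card_univ, smul_eq_mul] at h2
  have h3 : 0 < Fintype.card V := Fintype.card_pos
  have h4 : Fintype.card V < G.edgeFinset.card := by nlinarith
  have h5 : 0 < Module.finrank ℂ (Module.End.eigenspace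
        (Matrix.toLin' ((Pm G (1 : ℂ) 0) ^ 3 + (Pm G (1 : ℂ) 0)ᵀ)) (2 * s)) := by omega
  have := Module.finrank_pos_iff.1 h5
  obtain ⟨⟨h, hh⟩, hne⟩ := exists_ne (0 : Module.End.eigenspace
        (Matrix.toLin' ((Pm G (1 : ℂ) 0) ^ 3 + (Pm G (1 : ℂ) 0)ᵀ)) (2 * s))
  refine det_of_eig _ _ h (fun h0 => hne (Subtype.ext h0)) ?_
  rwa [Module.End.mem_eigenspace_iff, Matrix.toLin'_apply] at hh

lemma part_one (hreg : G.IsRegularOfDegree k) (hk : 2 < k) [Nonempty V] (lamA mu : ℂ)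
    (hl : Matrix.det (lamA • (1 : Matrix V V ℂ) - G.adjMatrix ℂ) = 0)
    (hmu : mu ^ 2 - (lamA ^ 3 - (3 * (k : ℂ) - 4) * lamA) * mu +
        (lamA ^ 4 - (k : ℂ) ^ 2 * lamA ^ 2 +
          2 * ((k : ℂ) - 1) * ((k : ℂ) ^ 2 - 2 * (k : ℂ) + 2)) = 0) :
    Matrix.det (mu • (1 : Matrix G.Dart G.Dart ℂ) -
      ((Pm G (1 : ℂ) 0) ^ 3 + (Pm G (1 : ℂ) 0)ᵀ)) = 0 := by
  obtain ⟨φ, hφ0, hφ⟩ := Matrix.exists_mulVec_eq_zero_iff.2 hl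
  have hA : G.adjMatrix ℂ *ᵥ φ = lamA • φ := by
    rw [Matrix.sub_mulVec, Matrix.smul_mulVec, Matrix.one_mulVec, sub_eq_zero] at hφ
    exact hφ.symm
  have hdet : Matrix.det !![lamA ^ 3 - 2 * ((k : ℂ) - 1) * lamA - mu,
      ((k : ℂ) - 1) * (lamA ^ 2 - k + 1) - 1;
      -lamA ^ 2 + 2 * ((k : ℂ) - 1), -((k : ℂ) - 2) * lamA - mu] = 0 := by
    rw [Matrix.det_fin_two_of]; linear_combination hmu
  obtain ⟨c, hc0, hc⟩ := Matrix.exists_mulVec_eq_zero_iff.2 hdet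
  have e1 := congrFun hc 0
  have e2 := congrFun hc 1
  simp [Matrix.mulVec, dotProduct, Fin.sum_univ_two] at e1 e2
  have hab : ¬ (c 0 = 0 ∧ c 1 = 0) := by
    rintro ⟨h0, h1⟩
    apply hc0; ext i; fin_cases i <;> simp [h0, h1]
  generalize c 0 = a at *
  generalize c 1 = b at *
  have hM := M_comb G k hreg φ lamA hA a b
  by_cases hz : a • Kf G φ + b • Lf G φ = 0
  · have hz' : ∀ x y, G.Adj x y → a * φ x + b * φ y = 0 := by
      intro x y hxy
      simpa [Kf, Lf] using congrFun hz ⟨(x, y), hxy⟩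
    obtain ⟨x, hx⟩ := Function.ne_iff.1 hφ0
    simp only [Pi.zero_apply] at hx
    have hdeg : 0 < G.degree x := by rw [hreg.degree_eq]; omega
    obtain ⟨y, hxy⟩ := (G.degree_pos_iff_exists_adj x).1 hdeg
    have f1 := hz' x y hxy
    have f2 := hz' y x hxy.symm
    have f3 : (a ^ 2 - b ^ 2) * φ x = 0 := by linear_combination a * f1 - b * f2
    have f4 : (a - b) * (a + b) = 0 := by
      rcases mul_eq_zero.1 f3 with h | h
      · linear_combination h
      · exact absurd h hx
    have hsum := sum_adj G φ lamA hA x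
    -- b = -s a
    have key : ∀ s : ℂ, s * s = 1 → b = -s * a → mu = 2 * s := by
      intro s hs hb
      have ha : a ≠ 0 := by
        rintro rfl; exact hab ⟨rfl, by simp [hb]⟩
      have g1 : ∀ u, G.Adj x u → φ u = s * φ x := by
        intro u hu
        have := hz' x u hu
        rw [hb] at this
        have h2 : a * (φ x - s * φ u) = 0 := by linear_combination this
        rcases mul_eq_zero.1 h2 with h | h
        · exact absurd h ha
        · linear_combination (-s) * h - φ u * hs
      have g2 : (∑ u, if G.Adj x u then φ u else 0) = ∑ u, if G.Adj x u then s * φ x else 0 := by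
        refine Finset.sum_congr rfl fun u _ => ?_
        split_ifs with h
        · exact g1 u h
        · rfl
      rw [g2, sum_adj_const G k hreg] at hsum
      have g3 : lamA = k * s := by
        apply mul_right_cancel₀ hx; linear_combination -hsum
      rw [g3, hb] at e1
      apply mul_left_cancel₀ ha
      have hs2 : s ^ 2 = 1 := by rw [pow_two, hs]
      have hs3 : s ^ 3 = s := by rw [pow_succ, hs2, one_mul]
      ring_nf at e1
      rw [hs3] at e1
      linear_combination -e1
    rcases mul_eq_zero.1 f4 with h | h
    · rw [key (-1) (by norm_num) (by linear_combination -h)]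
      exact det_two G k hreg hk _ (by norm_num)
    · rw [key 1 (by norm_num) (by linear_combination h)]
      exact det_two G k hreg hk _ (by norm_num)
  · refine det_of_eig _ mu _ hz ?_
    rw [hM, smul_add, smul_smul, smul_smul]
    congr 2
    · linear_combination e1
    · linear_combination e2

end

end Aux

/-- Corollary 5.4: eigenvalues of `(U³)⁺` for a connected `k`-regular graph
with `k > 2` and girth `> 4`: any root `μ` of
`μ² - (λ_A³-(3k-4)λ_A)μ + (λ_A⁴ - k²λ_A² + 2(k-1)(k²-2k+2)) = 0`, with `λ_A` an eigenvalue
of `A(G)`, is an eigenvalue of `(U³)⁺`; and if `m > n` then `±2` are eigenvalues with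
algebraic multiplicity at least `m - n`. -/
theorem eigenvalues_posSupp_grover_cube (G : SimpleGraph V) [DecidableRel G.Adj] (k : ℕ)
    (hconn : G.Connected) (hreg : G.IsRegularOfDegree k) (hk : 2 < k)
    (hg : 4 < G.egirth) :
    (∀ lamA mu : ℂ,
      Matrix.det (lamA • (1 : Matrix V V ℂ) - G.adjMatrix ℂ) = 0 →
      mu ^ 2 - (lamA ^ 3 - (3 * (k : ℂ) - 4) * lamA) * mu +
        (lamA ^ 4 - (k : ℂ) ^ 2 * lamA ^ 2 +
          2 * ((k : ℂ) - 1) * ((k : ℂ) ^ 2 - 2 * (k : ℂ) + 2)) = 0 →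
      Matrix.det (mu • (1 : Matrix G.Dart G.Dart ℂ) -
        (posSupp ((grover G) ^ 3)).map (fun x : ℝ => (x : ℂ))) = 0) ∧
    (Fintype.card V < G.edgeFinset.card →
      (Polynomial.X - Polynomial.C (2 : ℂ)) ^ (G.edgeFinset.card - Fintype.card V) ∣
        Matrix.charpoly ((posSupp ((grover G) ^ 3)).map (fun x : ℝ => (x : ℂ))) ∧
      (Polynomial.X + Polynomial.C (2 : ℂ)) ^ (G.edgeFinset.card - Fintype.card V) ∣
        Matrix.charpoly ((posSupp ((grover G) ^ 3)).map (fun x : ℝ => (x : ℂ)))) := by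
  have : Nonempty V := hconn.nonempty
  rw [posSupp_eq G k hreg hk hg]
  refine ⟨fun lamA mu hl hmu => part_one G k hreg hk lamA mu hl hmu, fun _ => ⟨?_, ?_⟩⟩
  · have := finrank_eig G 1 (by norm_num)
    rw [mul_one] at this
    exact dvd_charpoly_of _ _ _ this
  · have := finrank_eig G (-1) (by norm_num)
    have h2 := dvd_charpoly_of _ _ _ this
    simpa using h2
end

section
/- (Poles of the 3-modified zeta function) Let G be a connected k-regular finite simple graph with n vertices and m edges, where k > 2 and the girth g(G) > 4. If λ_A ∈ ℂ is an eigenvalue of the adjacency matrix A(G) and ρ ∈ ℂ satisfies (λ_A⁴ − k²·λ_A² + 2(k−1)(k²−2k+2))·ρ² − (λ_A³ − (3k−4)λ_A)·ρ + 1 = 0, then det(I_{2m} − ρ·(U³)⁺) = 0, i.e., ρ is a pole of the 3-modified zeta function Z₃(G,u). Moreover, if m > n then u = 1/2 and u = −1/2 are also poles, i.e., det(I_{2m} − (±1/2)·(U³)⁺) = 0. -/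
open Matrix SimpleGraph

variable {V : Type*} [Fintype V] [DecidableEq V]

namespace ThreeZeta

theorem dart_sum {R : Type*} [CommRing R] (G : SimpleGraph V) [DecidableRel G.Adj]
    (F : V → V → R) :
    ∑ d : G.Dart, F d.fst d.snd = ∑ u, ∑ v, if G.Adj u v then F u v else 0 := by
  rw [← Fintype.sum_prod_type' (f := fun u v => if G.Adj u v then F u v else 0),
    ← Finset.sum_filter]
  refine Finset.sum_bij (fun d _ => d.toProd) ?_ ?_ ?_ ?_
  · intro d _; simpa using d.adj
  · intro d _ d' _ h; exact SimpleGraph.Dart.ext _ _ h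
  · intro p hp; exact ⟨⟨p, by simpa using hp⟩, Finset.mem_univ _, rfl⟩
  · intro d _; rfl

/-- `S e f = 1` iff `t f = o e`. -/
def S (R : Type*) [CommRing R] (G : SimpleGraph V) [DecidableRel G.Adj] :
    Matrix G.Dart G.Dart R := fun e f => if f.snd = e.fst then 1 else 0

/-- Arc inversion. -/
def J (R : Type*) [CommRing R] (G : SimpleGraph V) [DecidableRel G.Adj] :
    Matrix G.Dart G.Dart R := fun e f => if f = e.symm then 1 else 0

/-- The weighted walk matrix. -/
def W {R : Type*} [CommRing R] (c : R) (G : SimpleGraph V) [DecidableRel G.Adj] :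
    Matrix G.Dart G.Dart R := c • S R G - J R G

section
variable {R : Type*} [CommRing R] (G : SimpleGraph V) [DecidableRel G.Adj]

theorem deg_sum {k : ℕ} (hreg : G.IsRegularOfDegree k) (u : V) :
    (∑ v, if G.Adj u v then (1 : R) else 0) = k := by
  have h := hreg u
  rw [← G.card_neighborFinset_eq_degree u] at h
  rw [Finset.sum_boole, ← h]
  congr 2; ext v; simp

theorem J_mulVec (h : G.Dart → R) (e : G.Dart) : (J R G *ᵥ h) e = h e.symm := by
  simp [Matrix.mulVec, dotProduct, J]

theorem J_mul (M : Matrix G.Dart G.Dart R) (e f : G.Dart) :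
    (J R G * M) e f = M e.symm f := by
  simp [Matrix.mul_apply, J]

theorem mul_J (M : Matrix G.Dart G.Dart R) (e f : G.Dart) :
    (M * J R G) e f = M e f.symm := by
  have : ∀ d : G.Dart, (f = d.symm) ↔ (d = f.symm) := fun d =>
    ⟨fun h => by simp [h], fun h => by simp [h]⟩
  simp [Matrix.mul_apply, J, this]

theorem JJ : J R G * J R G = 1 := by
  ext e f
  rw [J_mul, Matrix.one_apply]
  simp [J, eq_comm]

theorem SS (e f : G.Dart) :
    (S R G * S R G) e f = if G.Adj f.snd e.fst then 1 else 0 := by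
  simp only [Matrix.mul_apply, S]
  rw [dart_sum G (fun u v => (if v = e.fst then (1 : R) else 0) * (if f.snd = u then 1 else 0))]
  rw [Finset.sum_eq_single f.snd, Finset.sum_eq_single e.fst]
  · simp
  · intro v _ hv; simp [hv]
  · simp
  · intro u _ hu; simp [hu.symm]
  · simp

theorem SSS (e f : G.Dart) :
    (S R G * S R G * S R G) e f =
      ∑ v, if G.Adj f.snd v ∧ G.Adj v e.fst then 1 else 0 := by
  rw [Matrix.mul_apply]
  simp only [SS]
  simp only [S]
  rw [dart_sum G (fun u v => (if G.Adj v e.fst then (1 : R) else 0) * (if f.snd = u then 1 else 0))]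
  rw [Finset.sum_eq_single f.snd]
  · refine Finset.sum_congr rfl fun v _ => ?_
    by_cases h1 : G.Adj f.snd v <;> by_cases h2 : G.Adj v e.fst <;> simp [h1, h2]
  · intro u _ hu; simp [hu.symm]
  · simp

theorem SJS {k : ℕ} (hreg : G.IsRegularOfDegree k) (e f : G.Dart) :
    (S R G * J R G * S R G) e f = if f.snd = e.fst then (k : R) else 0 := by
  rw [Matrix.mul_apply]
  simp only [mul_J]
  simp only [S, SimpleGraph.Dart.symm_toProd, Prod.fst_swap, Prod.snd_swap]
  rw [dart_sum G (fun u v => (if u = e.fst then (1 : R) else 0) * (if f.snd = u then 1 else 0))]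
  rw [Finset.sum_eq_single e.fst]
  · by_cases h : f.snd = e.fst
    · simp only [h, if_true, mul_one]
      exact deg_sum G hreg e.fst
    · simp [h]
  · intro u _ hu; simp [hu]
  · simp

theorem W_cube (c : R) {k : ℕ} (hreg : G.IsRegularOfDegree k) (e f : G.Dart) :
    ((W c G) ^ 3) e f =
      c ^ 3 * (∑ v, if G.Adj f.snd v ∧ G.Adj v e.fst then 1 else 0)
      - c ^ 2 * ((if G.Adj f.fst e.fst then 1 else 0) + (if G.Adj f.snd e.snd then 1 else 0)
          + (if f.snd = e.fst then (k : R) else 0))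
      + c * (2 * (if f.snd = e.fst then 1 else 0) + (if f.fst = e.snd then 1 else 0))
      - (if f = e.symm then 1 else 0) := by
  have h : (W c G) ^ 3 = c ^ 3 • (S R G * S R G * S R G)
      - c ^ 2 • ((S R G * S R G) * J R G + J R G * (S R G * S R G) + S R G * J R G * S R G)
      + c • (S R G + S R G + J R G * (S R G * J R G)) - J R G := by
    have h1 : S R G * J R G * J R G = S R G := by rw [Matrix.mul_assoc, JJ, Matrix.mul_one]
    have h2 : J R G * (J R G * S R G) = S R G := by rw [← Matrix.mul_assoc, JJ, Matrix.one_mul]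
    simp only [W, pow_succ, pow_zero, one_mul, sub_mul, mul_sub, smul_mul_assoc, mul_smul_comm,
      JJ, h1, smul_sub, smul_add, smul_smul]
    simp only [Matrix.mul_assoc, h2, Matrix.one_mul, JJ]
    module
  rw [h]
  simp only [Matrix.sub_apply, Matrix.add_apply, Matrix.smul_apply, smul_eq_mul, SSS,
    SJS G hreg, mul_J, J_mul, SS]
  simp only [S, J, SimpleGraph.Dart.symm_toProd, Prod.fst_swap, Prod.snd_swap]
  ring

theorem grover_eq {k : ℕ} (hreg : G.IsRegularOfDegree k) : grover G = W (2 / (k : ℝ)) G := by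
  ext e f
  simp only [grover, W, S, J, Matrix.sub_apply, Matrix.smul_apply, smul_eq_mul, hreg e.fst]
  by_cases h : f = e.symm
  · subst h; simp
  · simp [h]

end

theorem unique_common (G : SimpleGraph V) (hg : 4 < G.egirth) {y z p q : V} (hyz : y ≠ z)
    (h1 : G.Adj y p) (h2 : G.Adj p z) (h3 : G.Adj y q) (h4 : G.Adj q z) : p = q := by
  by_contra hpq
  have hc : (SimpleGraph.Walk.cons h1 (.cons h2 (.cons h4.symm (.cons h3.symm .nil)))).IsCycle := by
    rw [SimpleGraph.Walk.cons_isCycle_iff]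
    have := h1.ne; have := h2.ne; have := h3.ne; have := h4.ne
    simp only [SimpleGraph.Walk.cons_isPath_iff]
    simp
    grind
  have := SimpleGraph.egirth_le_length hc
  simp at this
  exact absurd hg (not_lt.mpr this)

theorem posSupp_eq (G : SimpleGraph V) [DecidableRel G.Adj] {k : ℕ}
    (hreg : G.IsRegularOfDegree k) (hk : 2 < k) (hg : 4 < G.egirth) :
    posSupp ((grover G) ^ 3) = (W (1 : ℝ) G) ^ 3 + (W (1 : ℝ) G)ᵀ := by
  ext e f
  have hkR : (2 : ℝ) < k := by exact_mod_cast hk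
  set c : ℝ := 2 / (k : ℝ) with hc
  have hck : c * k = 2 := by rw [hc]; field_simp
  have hc0 : 0 < c := by positivity
  have hc1 : c < 1 := by rw [hc, div_lt_one (by linarith)]; exact hkR
  have hT : (W (1 : ℝ) G)ᵀ e f
      = (if f.fst = e.snd then 1 else 0) - (if f = e.symm then 1 else 0) := by
    have h1 : (e = f.symm) ↔ (f = e.symm) := ⟨fun h => by simp [h], fun h => by simp [h]⟩
    have h2 : (e.snd = f.fst) ↔ (f.fst = e.snd) := eq_comm
    simp [W, S, J, h1, h2]
  rw [Matrix.add_apply, hT, W_cube G 1 hreg, posSupp, grover_eq G hreg, W_cube G _ hreg, ← hc]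
  have hsymm : f = e.symm ↔ (f.fst = e.snd ∧ f.snd = e.fst) := by
    rw [SimpleGraph.Dart.ext_iff, Prod.ext_iff]; simp
  have hea := e.adj
  have hfa := f.adj
  simp only [hsymm]
  generalize f.fst = x at *
  generalize f.snd = y at *
  generalize e.fst = z at *
  generalize e.snd = w at *
  by_cases hyz : y = z
  · subst hyz
    have hA : (∑ v, if G.Adj y v ∧ G.Adj v y then (1 : ℝ) else 0) = k := by
      simp only [G.adj_comm _ y, and_self]
      exact deg_sum G hreg y
    rw [hA]
    have hn : ¬ (0 < c ^ 3 * (k : ℝ) - c ^ 2 * (1 + 1 + k) + c * (2 * 1 + if x = w then 1 else 0)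
        - if x = w then 1 else 0) := by
      have e1 : c ^ 3 * (k : ℝ) = 2 * c ^ 2 := by linear_combination c ^ 2 * hck
      have e2 : c ^ 2 * (k : ℝ) = 2 * c := by linear_combination c * hck
      split_ifs <;> nlinarith
    simp [hfa, hea] at hn ⊢
    rw [if_neg (not_lt.mpr hn)]
    ring
  · by_cases hxw : x = w
    · subst hxw
      have hA : (∑ v, if G.Adj y v ∧ G.Adj v z then (1 : ℝ) else 0) = 1 := by
        rw [Finset.sum_eq_single x]
        · simp [hfa.symm, hea.symm]
        · intro v _ hv
          rw [if_neg]
          rintro ⟨h1, h2⟩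
          exact hv (unique_common G hg hyz h1 h2 hfa.symm hea.symm)
        · simp
      rw [hA]
      have hp : 0 < c ^ 3 * 1 - c ^ 2 * (1 + 1) + c := by
        have : 0 < c * (1 - c) ^ 2 := by have := sub_pos.2 hc1; positivity
        nlinarith
      simp [hyz, hfa.symm, hea.symm] at hp ⊢
      exact hp
    · by_cases hex : ∃ p, G.Adj y p ∧ G.Adj p z
      · obtain ⟨p, hp1, hp2⟩ := hex
        have hA : (∑ v, if G.Adj y v ∧ G.Adj v z then (1 : ℝ) else 0) = 1 := by
          rw [Finset.sum_eq_single p]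
          · simp [hp1, hp2]
          · intro v _ hv
            rw [if_neg]
            rintro ⟨h1, h2⟩
            exact hv (unique_common G hg hyz h1 h2 hp1 hp2)
          · simp
        rw [hA]
        have hboth : ¬ (G.Adj x z ∧ G.Adj y w) := fun ⟨h1, h2⟩ =>
          hxw (unique_common G hg hyz hfa.symm h1 h2 hea.symm)
        have p1 : 0 < c ^ 3 := by positivity
        have p2 : ¬ (0 < c ^ 3 - c ^ 2) := by nlinarith [mul_pos hc0 hc0]
        by_cases a1 : G.Adj x z <;> by_cases a2 : G.Adj y w
        · exact absurd ⟨a1, a2⟩ hboth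
        all_goals simp [hyz, hxw, a1, a2] at p2 ⊢
        · exact p2
        · exact p2
        · exact p1
      · have hA : (∑ v, if G.Adj y v ∧ G.Adj v z then (1 : ℝ) else 0) = 0 :=
          Finset.sum_eq_zero fun v _ => if_neg fun h => hex ⟨v, h⟩
        have a1 : ¬ G.Adj x z := fun h => hex ⟨x, hfa.symm, h⟩
        have a2 : ¬ G.Adj y w := fun h => hex ⟨w, h, hea.symm⟩
        rw [hA]
        simp [hyz, hxw, a1, a2]

section
variable {R : Type*} [CommRing R] (G : SimpleGraph V) [DecidableRel G.Adj]

theorem W_transpose (c : R) : (W c G)ᵀ = J R G * W c G * J R G := by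
  ext e f
  rw [mul_J, J_mul]
  have h1 : (e = f.symm) ↔ (f = e.symm) := ⟨fun h => by simp [h], fun h => by simp [h]⟩
  have h2 : (f.symm = e) ↔ (f = e.symm) := ⟨fun h => by simp [← h], fun h => by simp [h]⟩
  have h3 : (e.snd = f.fst) ↔ (f.fst = e.snd) := eq_comm
  simp [W, S, J, h1, h2, h3]

theorem S_mulVec_fst (φ : V → R) (l : R) (hφ : G.adjMatrix R *ᵥ φ = l • φ) :
    S R G *ᵥ (fun e : G.Dart => φ e.fst) = l • (fun e : G.Dart => φ e.fst) := by
  funext e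
  simp only [Matrix.mulVec, dotProduct, S]
  rw [dart_sum G (fun u v => (if v = e.fst then (1 : R) else 0) * φ u)]
  have := congrFun hφ e.fst
  simp only [Pi.smul_apply] at this ⊢
  rw [← this]
  simp only [Matrix.mulVec, dotProduct, SimpleGraph.adjMatrix_apply]
  refine Finset.sum_congr rfl fun u _ => ?_
  rw [Finset.sum_eq_single e.fst]
  · simp [G.adj_comm u e.fst]
  · intro v _ hv; simp [hv]
  · simp

theorem S_mulVec_snd {k : ℕ} (hreg : G.IsRegularOfDegree k) (φ : V → R) :
    S R G *ᵥ (fun e : G.Dart => φ e.snd) = (k : R) • (fun e : G.Dart => φ e.fst) := by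
  funext e
  simp only [Matrix.mulVec, dotProduct, S]
  rw [dart_sum G (fun u v => (if v = e.fst then (1 : R) else 0) * φ v)]
  simp only [Pi.smul_apply, smul_eq_mul]
  rw [← deg_sum G hreg e.fst, Finset.sum_mul]
  refine Finset.sum_congr rfl fun u _ => ?_
  rw [Finset.sum_eq_single e.fst]
  · simp [G.adj_comm u e.fst]
  · intro v _ hv; simp [hv]
  · simp

/-- Action of the 3-modified matrix on the span of `φ ∘ o` and `φ ∘ t`. -/
theorem M_mulVec {k : ℕ} (hreg : G.IsRegularOfDegree k) (φ : V → R) (l : R)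
    (hφ : G.adjMatrix R *ᵥ φ = l • φ) (α β : R) :
    ((W (1 : R) G) ^ 3 + (W (1 : R) G)ᵀ) *ᵥ (fun e : G.Dart => α * φ e.fst + β * φ e.snd) =
      fun e : G.Dart =>
        (α * ((l ^ 2 - k + 1) * l - (k - 1) * l) + β * ((l ^ 2 - k + 1) * (k - 1) - 1)) * φ e.fst
        + (α * (-(l ^ 2 - k + 1) + k - 1) + β * (-(k - 1) * l + l)) * φ e.snd := by
  set a : G.Dart → R := fun e => φ e.fst with ha
  set b : G.Dart → R := fun e => φ e.snd with hb
  have hJa : J R G *ᵥ a = b := by funext e; rw [J_mulVec]; rfl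
  have hJb : J R G *ᵥ b = a := by funext e; rw [J_mulVec]; rfl
  have hNa : W (1 : R) G *ᵥ a = l • a - b := by
    rw [W, one_smul, Matrix.sub_mulVec, hJa, S_mulVec_fst G φ l hφ]
  have hNb : W (1 : R) G *ᵥ b = ((k : R) - 1) • a := by
    rw [W, one_smul, Matrix.sub_mulVec, hJb, S_mulVec_snd G hreg φ, sub_smul, one_smul]
  have hh : (fun e : G.Dart => α * φ e.fst + β * φ e.snd) = α • a + β • b := rfl
  rw [hh, W_transpose, Matrix.add_mulVec, pow_succ, pow_two]
  simp only [← Matrix.mulVec_mulVec, Matrix.mulVec_add, Matrix.mulVec_sub, Matrix.mulVec_smul,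
    hNa, hNb, hJa, hJb]
  funext e
  simp only [Pi.add_apply, Pi.sub_apply, Pi.smul_apply, smul_eq_mul, ha, hb]
  ring

theorem M_mulVec_circ (h : G.Dart → R) (ε : R) (hε : ε ^ 2 = 1) (hS : S R G *ᵥ h = 0)
    (hJ : J R G *ᵥ h = ε • h) :
    ((W (1 : R) G) ^ 3 + (W (1 : R) G)ᵀ) *ᵥ h = (-2 * ε) • h := by
  have hN : W (1 : R) G *ᵥ h = (-ε) • h := by
    rw [W, one_smul, Matrix.sub_mulVec, hJ, hS, zero_sub, neg_smul]
  rw [W_transpose, Matrix.add_mulVec, pow_succ, pow_two]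
  simp only [← Matrix.mulVec_mulVec, Matrix.mulVec_smul, hN, hJ]
  funext e
  simp only [Pi.add_apply, Pi.smul_apply, smul_eq_mul]
  linear_combination (-2 * ε * h e) * hε

end

theorem exists_circ (G : SimpleGraph V) [DecidableRel G.Adj]
    (hcard : Fintype.card V < G.edgeFinset.card) (s : G.Dart → ℝ) (ε : ℝ)
    (hs0 : ∀ d, s d ≠ 0) (hs : ∀ d, s d.symm = ε * s d) :
    ∃ h : G.Dart → ℝ, h ≠ 0 ∧ S ℝ G *ᵥ h = 0 ∧ J ℝ G *ᵥ h = ε • h := by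
  let P : (G.edgeSet → ℝ) →ₗ[ℝ] (G.Dart → ℝ) :=
    { toFun := fun x d => s d * x ⟨d.edge, d.edge_mem⟩
      map_add' := by intro x y; funext d; simp [mul_add]
      map_smul' := by intro r x; funext d; simp; ring }
  let Q : (G.Dart → ℝ) →ₗ[ℝ] (V → ℝ) :=
    { toFun := fun h v => ∑ f : G.Dart, (if f.snd = v then 1 else 0) * h f
      map_add' := by intro x y; funext v; simp only [Pi.add_apply, mul_add, Finset.sum_add_distrib]
      map_smul' := by
        intro r x; funext v
        simp only [Pi.smul_apply, smul_eq_mul, Finset.mul_sum, RingHom.id_apply]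
        exact Finset.sum_congr rfl fun f _ => by ring }
  have hker : LinearMap.ker (Q ∘ₗ P) ≠ ⊥ := by
    apply LinearMap.ker_ne_bot_of_finrank_lt
    rw [Module.finrank_fintype_fun_eq_card, Module.finrank_fintype_fun_eq_card]
    rwa [SimpleGraph.edgeFinset_card] at hcard
  obtain ⟨x, hx, hx0⟩ := Submodule.exists_mem_ne_zero_of_ne_bot hker
  refine ⟨P x, ?_, ?_, ?_⟩
  · intro h0
    apply hx0
    funext ⟨e, he⟩
    induction e with
    | _ u v =>
      have := congrFun h0 ⟨(u, v), he⟩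
      simp only [P, LinearMap.coe_mk, AddHom.coe_mk, Pi.zero_apply, mul_eq_zero] at this
      exact this.resolve_left (hs0 _)
  · funext e
    exact congrFun (LinearMap.mem_ker.mp hx) e.fst
  · funext e
    rw [J_mulVec]
    simp only [P, LinearMap.coe_mk, AddHom.coe_mk, Pi.smul_apply, smul_eq_mul, hs e,
      SimpleGraph.Dart.edge_symm, mul_assoc]

theorem det_circ (G : SimpleGraph V) [DecidableRel G.Adj]
    (hcard : Fintype.card V < G.edgeFinset.card) (s : G.Dart → ℝ) (ε r : ℝ)
    (hs0 : ∀ d, s d ≠ 0) (hs : ∀ d, s d.symm = ε * s d) (hε : ε ^ 2 = 1) (hr : r * (-2 * ε) = 1) :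
    Matrix.det ((1 : Matrix G.Dart G.Dart ℝ)
      - r • ((W (1 : ℝ) G) ^ 3 + (W (1 : ℝ) G)ᵀ)) = 0 := by
  obtain ⟨h, h0, hS, hJ⟩ := exists_circ G hcard s ε hs0 hs
  refine Matrix.exists_mulVec_eq_zero_iff.mp ⟨h, h0, ?_⟩
  rw [Matrix.sub_mulVec, Matrix.one_mulVec, Matrix.smul_mulVec, M_mulVec_circ G h ε hε hS hJ,
    smul_smul, hr, one_smul, sub_self]

theorem det_half (G : SimpleGraph V) [DecidableRel G.Adj]
    (hcard : Fintype.card V < G.edgeFinset.card) :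
    Matrix.det ((1 : Matrix G.Dart G.Dart ℝ)
      - ((1 : ℝ) / 2) • ((W (1 : ℝ) G) ^ 3 + (W (1 : ℝ) G)ᵀ)) = 0 := by
  let q := Fintype.equivFin V
  refine det_circ G hcard (fun d => if q d.fst < q d.snd then 1 else -1) (-1) _ ?_ ?_
    (by norm_num) (by norm_num)
  · intro d; split_ifs <;> norm_num
  · intro d
    have hne : q d.fst ≠ q d.snd := fun h => d.adj.ne (q.injective h)
    simp only [SimpleGraph.Dart.symm_toProd, Prod.fst_swap, Prod.snd_swap]
    rcases lt_or_gt_of_ne hne with h | h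
    · rw [if_pos h, if_neg h.not_gt]; norm_num
    · rw [if_neg h.not_gt, if_pos h]; norm_num

theorem det_neg_half (G : SimpleGraph V) [DecidableRel G.Adj]
    (hcard : Fintype.card V < G.edgeFinset.card) :
    Matrix.det ((1 : Matrix G.Dart G.Dart ℝ)
      - (-(1 : ℝ) / 2) • ((W (1 : ℝ) G) ^ 3 + (W (1 : ℝ) G)ᵀ)) = 0 :=
  det_circ G hcard (fun _ => 1) 1 _ (by simp) (by simp) (by norm_num) (by norm_num)

theorem card_lt (G : SimpleGraph V) [DecidableRel G.Adj] {k : ℕ} [Nonempty V]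
    (hreg : G.IsRegularOfDegree k) (hk : 2 < k) : Fintype.card V < G.edgeFinset.card := by
  have h := G.sum_degrees_eq_twice_card_edges
  rw [Finset.sum_congr rfl (fun v _ => hreg.degree_eq v), Finset.sum_const, Finset.card_univ,
    smul_eq_mul] at h
  have : 0 < Fintype.card V := Fintype.card_pos
  nlinarith

theorem W_map (G : SimpleGraph V) [DecidableRel G.Adj] :
    ((W (1 : ℝ) G) ^ 3 + (W (1 : ℝ) G)ᵀ).map (fun x : ℝ => (x : ℂ)) =
      (W (1 : ℂ) G) ^ 3 + (W (1 : ℂ) G)ᵀ := by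
  have h : Complex.ofRealHom.mapMatrix (W (1 : ℝ) G) = W (1 : ℂ) G := by
    ext e f
    simp only [RingHom.mapMatrix_apply, Matrix.map_apply, W, S, J, Matrix.sub_apply, one_smul]
    split_ifs <;> simp
  have h2 : Complex.ofRealHom.mapMatrix ((W (1 : ℝ) G)ᵀ) = (W (1 : ℂ) G)ᵀ := by
    rw [← h]; rfl
  have h3 := map_add Complex.ofRealHom.mapMatrix ((W (1 : ℝ) G) ^ 3) ((W (1 : ℝ) G)ᵀ)
  rw [map_pow, h, h2] at h3
  exact h3

theorem det_complex (G : SimpleGraph V) [DecidableRel G.Adj] (r : ℝ)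
    (h : Matrix.det ((1 : Matrix G.Dart G.Dart ℝ)
      - r • ((W (1 : ℝ) G) ^ 3 + (W (1 : ℝ) G)ᵀ)) = 0) :
    Matrix.det ((1 : Matrix G.Dart G.Dart ℂ)
      - (r : ℂ) • ((W (1 : ℂ) G) ^ 3 + (W (1 : ℂ) G)ᵀ)) = 0 := by
  have h1 := congrArg Complex.ofRealHom h
  rw [RingHom.map_det, map_zero] at h1
  rw [← h1, ← W_map]
  congr 1
  rw [map_sub, map_one]
  congr 1
  ext e f
  simp only [Matrix.smul_apply, Matrix.map_apply, RingHom.mapMatrix_apply, smul_eq_mul,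
    Complex.ofRealHom_eq_coe, Complex.ofReal_mul]

theorem main_complex (G : SimpleGraph V) [DecidableRel G.Adj] {k : ℕ}
    (hreg : G.IsRegularOfDegree k) (hcard : Fintype.card V < G.edgeFinset.card)
    (hk : 2 < k) (l ρ : ℂ)
    (hl : Matrix.det (l • (1 : Matrix V V ℂ) - G.adjMatrix ℂ) = 0)
    (hρ : (l ^ 4 - (k : ℂ) ^ 2 * l ^ 2 +
          2 * ((k : ℂ) - 1) * ((k : ℂ) ^ 2 - 2 * (k : ℂ) + 2)) * ρ ^ 2 -
        (l ^ 3 - (3 * (k : ℂ) - 4) * l) * ρ + 1 = 0) :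
    Matrix.det ((1 : Matrix G.Dart G.Dart ℂ)
      - ρ • ((W (1 : ℂ) G) ^ 3 + (W (1 : ℂ) G)ᵀ)) = 0 := by
  obtain ⟨φ, hφ0, hφ⟩ := Matrix.exists_mulVec_eq_zero_iff.mpr hl
  have hφ' : G.adjMatrix ℂ *ᵥ φ = l • φ := by
    rw [Matrix.sub_mulVec, Matrix.smul_mulVec, Matrix.one_mulVec, sub_eq_zero] at hφ
    exact hφ.symm
  set m11 : ℂ := (l ^ 2 - k + 1) * l - (k - 1) * l with h11
  set m12 : ℂ := (l ^ 2 - k + 1) * (k - 1) - 1 with h12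
  set m21 : ℂ := -(l ^ 2 - k + 1) + k - 1 with h21
  set m22 : ℂ := -(k - 1) * l + l with h22
  have hdet : Matrix.det !![1 - ρ * m11, -ρ * m12; -ρ * m21, 1 - ρ * m22] = 0 := by
    rw [Matrix.det_fin_two_of, ← hρ, h11, h12, h21, h22]
    ring
  obtain ⟨c, hc0, hc⟩ := Matrix.exists_mulVec_eq_zero_iff.mpr hdet
  have e1 := congrFun hc 0
  have e2 := congrFun hc 1
  simp [Matrix.mulVec, dotProduct, Fin.sum_univ_two] at e1 e2
  set α := c 0
  set β := c 1
  have hαβ : ¬ (α = 0 ∧ β = 0) := by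
    rintro ⟨h1, h2⟩
    apply hc0
    funext i
    fin_cases i
    · exact h1
    · exact h2
  by_cases hz : (fun e : G.Dart => α * φ e.fst + β * φ e.snd) = 0
  · -- degenerate case: `l = ± k` and `ρ = ± 1/2`
    have hd : ∀ u v, G.Adj u v → α * φ u + β * φ v = 0 := fun u v h =>
      congrFun hz ⟨(u, v), h⟩
    obtain ⟨u, hu⟩ : ∃ u, φ u ≠ 0 := by
      by_contra! h
      exact hφ0 (funext h)
    have hlu := congrFun hφ' u
    simp only [Matrix.mulVec, dotProduct, SimpleGraph.adjMatrix_apply, Pi.smul_apply,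
      smul_eq_mul] at hlu
    have key : ∀ δ : ℂ, (∀ v, G.Adj u v → φ v = δ * φ u) → l = δ * k := by
      intro δ hδ
      have : ∑ v, (if G.Adj u v then (1 : ℂ) else 0) * φ v = (k : ℂ) * (δ * φ u) := by
        rw [← deg_sum G hreg u, Finset.sum_mul]
        refine Finset.sum_congr rfl fun v _ => ?_
        by_cases h : G.Adj u v
        · simp [h, hδ v h]
        · simp [h]
      rw [this] at hlu
      apply mul_right_cancel₀ hu
      rw [← hlu]; ring
    obtain ⟨w, hw⟩ : ∃ w, G.Adj u w := by
      by_contra! h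
      have h1 := deg_sum (R := ℂ) G hreg u
      simp only [h, if_false, Finset.sum_const_zero] at h1
      have : k = 0 := by exact_mod_cast h1.symm
      omega
    have hρ0 : ρ ≠ 0 := by
      rintro rfl
      simp at hρ
    by_cases hs : α + β = 0
    · have hβ : β = -α := by linear_combination hs
      have hα : α ≠ 0 := fun h => hαβ ⟨h, by rw [hβ, h, neg_zero]⟩
      have hlk : l = 1 * k := key 1 fun v hv => by
        have := hd u v hv
        rw [hβ] at this
        apply mul_left_cancel₀ hα
        linear_combination -this
      have : ρ = (((1 : ℝ) / 2 : ℝ) : ℂ) := by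
        have h3 : α * (1 - 2 * ρ) = 0 := by
          rw [hβ] at e1
          rw [← e1, h11, h12, hlk]
          ring
        have h4 := (mul_eq_zero.mp h3).resolve_left hα
        push_cast
        linear_combination (-1 / 2) * h4
      rw [this]
      exact det_complex G _ (det_half G hcard)
    · have hneg : ∀ v, G.Adj u v → φ v = -1 * φ u := fun v hv => by
        have h1 := hd u v hv
        have h2 := hd v u hv.symm
        apply mul_left_cancel₀ hs
        linear_combination h1 + h2
      have hlk : l = -1 * k := key (-1) hneg
      have hβ : β = α := by
        have h1 := hd u w hw
        rw [hneg w hw] at h1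
        apply mul_right_cancel₀ hu
        linear_combination -h1
      have hα : α ≠ 0 := fun h => hαβ ⟨h, by rw [hβ, h]⟩
      have : ρ = ((-(1 : ℝ) / 2 : ℝ) : ℂ) := by
        have h3 : α * (1 + 2 * ρ) = 0 := by
          rw [hβ] at e1
          rw [← e1, h11, h12, hlk]
          ring
        have h4 := (mul_eq_zero.mp h3).resolve_left hα
        push_cast
        linear_combination (1 / 2) * h4
      rw [this]
      exact det_complex G _ (det_neg_half G hcard)
  · refine Matrix.exists_mulVec_eq_zero_iff.mp ⟨_, hz, ?_⟩
    rw [Matrix.sub_mulVec, Matrix.one_mulVec, Matrix.smul_mulVec, M_mulVec G hreg φ l hφ']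
    funext e
    simp only [Pi.sub_apply, Pi.smul_apply, smul_eq_mul, Pi.zero_apply, ← h11, ← h12, ← h21,
      ← h22]
    linear_combination φ e.fst * e1 + φ e.snd * e2

end ThreeZeta

/-- Theorem 6.1, poles of the 3-modified zeta function: for a connected
`k`-regular graph with `k > 2` and girth `> 4`, any root `ρ` of
`(λ_A⁴ - k²λ_A² + 2(k-1)(k²-2k+2))ρ² - (λ_A³-(3k-4)λ_A)ρ + 1 = 0` with `λ_A` an eigenvalue
of `A(G)` satisfies `det(I_{2m} - ρ (U³)⁺) = 0`; and if `m > n` then `±1/2` are also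
zeros of `det(I_{2m} - u (U³)⁺)`. -/
theorem poles_three_modified_zeta (G : SimpleGraph V) [DecidableRel G.Adj] (k : ℕ)
    (hconn : G.Connected) (hreg : G.IsRegularOfDegree k) (hk : 2 < k)
    (hg : 4 < G.egirth) :
    (∀ lamA rho : ℂ,
      Matrix.det (lamA • (1 : Matrix V V ℂ) - G.adjMatrix ℂ) = 0 →
      (lamA ^ 4 - (k : ℂ) ^ 2 * lamA ^ 2 +
          2 * ((k : ℂ) - 1) * ((k : ℂ) ^ 2 - 2 * (k : ℂ) + 2)) * rho ^ 2 -
        (lamA ^ 3 - (3 * (k : ℂ) - 4) * lamA) * rho + 1 = 0 →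
      Matrix.det ((1 : Matrix G.Dart G.Dart ℂ) -
        rho • (posSupp ((grover G) ^ 3)).map (fun x : ℝ => (x : ℂ))) = 0) ∧
    (Fintype.card V < G.edgeFinset.card →
      Matrix.det ((1 : Matrix G.Dart G.Dart ℝ) -
        ((1 : ℝ) / 2) • posSupp ((grover G) ^ 3)) = 0 ∧
      Matrix.det ((1 : Matrix G.Dart G.Dart ℝ) -
        (-(1 : ℝ) / 2) • posSupp ((grover G) ^ 3)) = 0) := by
  haveI : Nonempty V := hconn.nonempty
  rw [ThreeZeta.posSupp_eq G hreg hk hg]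
  refine ⟨fun l ρ hl hρ => ?_, fun hcard =>
    ⟨ThreeZeta.det_half G hcard, ThreeZeta.det_neg_half G hcard⟩⟩
  rw [ThreeZeta.W_map]
  exact ThreeZeta.main_complex G hreg (ThreeZeta.card_lt G hreg hk) hk l ρ hl hρ
end
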